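/- arXiv:1712.09457 — 5 statements merged into one kernel-verified Lean document; each statement's English description precedes it below -/
import Mathlib

section
/- There exists a constant C > 0 with the following property. Let φ : ℝ² → ℝ be a C² function and λ > 0 with Δφ = −λφ on the unit square D = [0,1]², φ = 0 on ∂D, φ not identically zero, and suppose φ has no interior singular point. Let j(λ) = #{(a,b) ∈ ℤ≥1 × ℤ≥1 : π²(a²+b²) ≤ λ} be the number of Dirichlet eigenvalues of D that are at most λ, counted with multiplicity. Then N(φ) ≤ (2/π)·j(λ) + C·√λ. -/
open Real

/-- The Euclidean Laplacian of a function `φ : ℝ × ℝ → ℝ`. -/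
noncomputable def laplacian2 (φ : ℝ × ℝ → ℝ) (p : ℝ × ℝ) : ℝ :=
  deriv (fun x => deriv (fun x' => φ (x', p.2)) x) p.1 +
  deriv (fun y => deriv (fun y' => φ (p.1, y')) y) p.2

/-- The Dirichlet eigenvalue counting function of the unit square:
`j(λ) = #{(a,b) ∈ ℤ≥1 × ℤ≥1 : π²(a²+b²) ≤ λ}`. -/
noncomputable def squareCounting (lam : ℝ) : ℕ :=
  Nat.card {ab : ℕ × ℕ // 1 ≤ ab.1 ∧ 1 ≤ ab.2 ∧
    π ^ 2 * ((ab.1 : ℝ) ^ 2 + (ab.2 : ℝ) ^ 2) ≤ lam}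

/-- `A` is a connected component of the set `W`. -/
def IsComponentOf {X : Type*} [TopologicalSpace X] (W A : Set X) : Prop :=
  ∃ p ∈ W, connectedComponentIn W p = A

namespace IsComponentOf

variable {X : Type*} [TopologicalSpace X] {W A B S : Set X}

theorem subset (h : IsComponentOf W A) : A ⊆ W := by
  obtain ⟨p, -, rfl⟩ := h
  exact connectedComponentIn_subset W p

theorem nonempty (h : IsComponentOf W A) : A.Nonempty := by
  obtain ⟨p, hp, rfl⟩ := h
  exact ⟨p, mem_connectedComponentIn hp⟩

theorem isPreconnected (h : IsComponentOf W A) : IsPreconnected A := by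
  obtain ⟨p, -, rfl⟩ := h
  exact isPreconnected_connectedComponentIn

theorem isOpen [LocallyConnectedSpace X] (hW : IsOpen W) (h : IsComponentOf W A) : IsOpen A := by
  obtain ⟨p, -, rfl⟩ := h
  exact hW.connectedComponentIn

theorem subset_of_isPreconnected (h : IsComponentOf W A) (hS : IsPreconnected S) (hSW : S ⊆ W)
    (hne : (S ∩ A).Nonempty) : S ⊆ A := by
  obtain ⟨p, -, rfl⟩ := h
  obtain ⟨x, hxS, hxA⟩ := hne
  rw [connectedComponentIn_eq hxA]
  exact hS.subset_connectedComponentIn hxS hSW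

theorem eq_of_mem (hA : IsComponentOf W A) (hB : IsComponentOf W B) {x : X} (hxA : x ∈ A)
    (hxB : x ∈ B) : A = B :=
  (hB.subset_of_isPreconnected hA.isPreconnected hA.subset ⟨x, hxA, hxB⟩).antisymm
    (hA.subset_of_isPreconnected hB.isPreconnected hB.subset ⟨x, hxB, hxA⟩)

theorem closure_inter_subset [LocallyConnectedSpace X] (hW : IsOpen W) (h : IsComponentOf W A) :
    closure A ∩ W ⊆ A := by
  rintro x ⟨hxA, hxW⟩
  have hB : IsComponentOf W (connectedComponentIn W x) := ⟨x, hxW, rfl⟩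
  have hx := mem_connectedComponentIn hxW
  obtain ⟨y, hyB, hyA⟩ := mem_closure_iff.1 hxA _ (hB.isOpen hW) hx
  exact h.eq_of_mem hB hyA hyB ▸ hx

/-- The last parameter of a path in `(0, 1)` belonging to a component. -/
theorem exists_top [LocallyConnectedSpace X] (hW : IsOpen W) (h : IsComponentOf W A) {l : ℝ → X}
    (hl : Continuous l) (hfin : {t ∈ Set.Ioo (0 : ℝ) 1 | l t ∉ W}.Finite)
    (hne : ∃ t ∈ Set.Ioo (0 : ℝ) 1, l t ∈ A) :
    ∃ t ∈ Set.Ioc (0 : ℝ) 1, (∀ s ∈ Set.Ioo (0 : ℝ) 1, l s ∈ A → s < t) ∧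
      (∃ t' < t, ∀ s ∈ Set.Ioo t' t, l s ∈ A) ∧ l t ∈ closure A ∧
      (t = 1 ∨ t ∈ {t ∈ Set.Ioo (0 : ℝ) 1 | l t ∉ W}) := by
  set T : Set ℝ := {t ∈ Set.Ioo (0 : ℝ) 1 | l t ∈ A} with hT
  have hTo : IsOpen T := isOpen_Ioo.inter ((h.isOpen hW).preimage hl)
  have hTne : T.Nonempty := hne
  have hTb : BddAbove T := ⟨1, fun s hs => hs.1.2.le⟩
  set t := sSup T with ht
  have htT : t ∉ T := by
    intro htT
    obtain ⟨ε, hε, hb⟩ := Metric.isOpen_iff.1 hTo t htT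
    have : t + ε / 2 ∈ T := hb (by
      rw [Metric.mem_ball, Real.dist_eq, add_sub_cancel_left, abs_of_pos (half_pos hε)]
      exact half_lt_self hε)
    have := le_csSup hTb this
    linarith
  have hlt : ∀ s ∈ T, s < t := fun s hs =>
    lt_of_le_of_ne (le_csSup hTb hs) fun h => htT (h ▸ hs)
  have ht0 : 0 < t := by
    obtain ⟨s, hs⟩ := hTne
    exact hs.1.1.trans (hlt s hs)
  have ht1 : t ≤ 1 := csSup_le hTne fun s hs => hs.1.2.le
  obtain ⟨t', ht', htA⟩ : ∃ t' < t, ∀ s ∈ Set.Ioo t' t, l s ∈ A := by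
    have hmem : ({t ∈ Set.Ioo (0 : ℝ) 1 | l t ∉ W} \ {t})ᶜ ∈ nhds t :=
      (hfin.subset Set.sdiff_subset).isClosed.isOpen_compl.mem_nhds (by simp)
    obtain ⟨t', ht', hI⟩ := (mem_nhdsLE_iff_exists_Ioc_subset' ht0).1
      (nhdsWithin_le_nhds hmem)
    have hsub : l '' Set.Ioo (max 0 t') t ⊆ W := by
      rintro _ ⟨s, hs, rfl⟩
      have h1 := hI ⟨(le_max_right _ _).trans_lt hs.1, hs.2.le⟩
      by_contra hW
      exact h1 ⟨⟨⟨(le_max_left _ _).trans_lt hs.1, hs.2.trans_le ht1⟩, hW⟩, hs.2.ne⟩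
    have hm : max 0 t' < t := max_lt ht0 ht'
    obtain ⟨s, hs, hst⟩ := exists_lt_of_lt_csSup hTne hm
    have := h.subset_of_isPreconnected (isPreconnected_Ioo.image _ hl.continuousOn) hsub
      ⟨l s, ⟨s, ⟨hst, hlt s hs⟩, rfl⟩, hs.2⟩
    exact ⟨max 0 t', hm, fun s hs => this ⟨s, hs, rfl⟩⟩
  have hcl : l t ∈ closure A := by
    have h1 : t ∈ closure (Set.Ioo t' t) := by
      rw [closure_Ioo ht'.ne]
      exact ⟨ht'.le, le_rfl⟩
    exact closure_mono (Set.image_subset_iff.2 htA)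
      (hl.continuousWithinAt.mem_closure_image h1)
  refine ⟨t, ⟨ht0, ht1⟩, fun s hs hsA => hlt s ⟨hs, hsA⟩, ⟨t', ht', htA⟩, hcl, ?_⟩
  rcases ht1.eq_or_lt with h1 | h1
  · exact Or.inl h1
  · refine Or.inr ⟨⟨ht0, h1⟩, fun hWt => htT ⟨⟨ht0, h1⟩, ?_⟩⟩
    exact h.closure_inter_subset hW ⟨hcl, hWt⟩

/-- The first parameter of a path in `(0, 1)` belonging to a component. -/
theorem exists_bot [LocallyConnectedSpace X] (hW : IsOpen W) (h : IsComponentOf W A) {l : ℝ → X}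
    (hl : Continuous l) (hfin : {t ∈ Set.Ioo (0 : ℝ) 1 | l t ∉ W}.Finite)
    (hne : ∃ t ∈ Set.Ioo (0 : ℝ) 1, l t ∈ A) :
    ∃ t ∈ Set.Ico (0 : ℝ) 1, (∀ s ∈ Set.Ioo (0 : ℝ) 1, l s ∈ A → t < s) ∧
      (∃ t' > t, ∀ s ∈ Set.Ioo t t', l s ∈ A) ∧ l t ∈ closure A ∧
      (t = 0 ∨ t ∈ {t ∈ Set.Ioo (0 : ℝ) 1 | l t ∉ W}) := by
  have hfin' : {t ∈ Set.Ioo (0 : ℝ) 1 | l (1 - t) ∉ W}.Finite := by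
    refine (hfin.image fun t => 1 - t).subset ?_
    rintro t ⟨⟨h0, h1⟩, hW⟩
    exact ⟨1 - t, ⟨⟨by linarith, by linarith⟩, hW⟩, by ring⟩
  obtain ⟨t, ⟨h0, h1⟩, hlt, ⟨t', ht', htA⟩, hcl, hor⟩ :=
    h.exists_top hW (l := fun t => l (1 - t)) (hl.comp (by fun_prop)) hfin' (by
      obtain ⟨t, ⟨h0, h1⟩, ht⟩ := hne
      exact ⟨1 - t, ⟨by linarith, by linarith⟩, by simpa using ht⟩)
  refine ⟨1 - t, ⟨by linarith, by linarith⟩, fun s hs hsA => ?_,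
    ⟨1 - t', by linarith, fun s hs => ?_⟩, hcl, ?_⟩
  · have := hlt (1 - s) ⟨by linarith [hs.2], by linarith [hs.1]⟩ (by simpa using hsA)
    linarith
  · simpa using htA (1 - s) ⟨by linarith [hs.2], by linarith [hs.1]⟩
  · rcases hor with h | ⟨⟨h2, h3⟩, h4⟩
    · exact Or.inl (by linarith)
    · exact Or.inr ⟨⟨by linarith, by linarith⟩, h4⟩

theorem eq_of_eventually_mem_left (hA : IsComponentOf W A) (hB : IsComponentOf W B) {l : ℝ → X}
    {t : ℝ} (h1 : ∃ t' < t, ∀ s ∈ Set.Ioo t' t, l s ∈ A)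
    (h2 : ∃ t' < t, ∀ s ∈ Set.Ioo t' t, l s ∈ B) : A = B := by
  obtain ⟨a, ha, hA'⟩ := h1
  obtain ⟨b, hb, hB'⟩ := h2
  obtain ⟨s, hs1, hs2⟩ := exists_between (max_lt ha hb)
  exact hA.eq_of_mem hB (hA' s ⟨(le_max_left _ _).trans_lt hs1, hs2⟩)
    (hB' s ⟨(le_max_right _ _).trans_lt hs1, hs2⟩)

theorem eq_of_eventually_mem_right (hA : IsComponentOf W A) (hB : IsComponentOf W B) {l : ℝ → X}
    {t : ℝ} (h1 : ∃ t' > t, ∀ s ∈ Set.Ioo t t', l s ∈ A)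
    (h2 : ∃ t' > t, ∀ s ∈ Set.Ioo t t', l s ∈ B) : A = B := by
  obtain ⟨a, ha, hA'⟩ := h1
  obtain ⟨b, hb, hB'⟩ := h2
  obtain ⟨s, hs1, hs2⟩ := exists_between (lt_min ha hb)
  exact hA.eq_of_mem hB (hA' s ⟨hs1, hs2.trans_le (min_le_left _ _)⟩)
    (hB' s ⟨hs1, hs2.trans_le (min_le_right _ _)⟩)

/-- A path leaving `W` at finitely many parameters meets at most one more component of `W`. -/
theorem card_le_ncard_add_one [LocallyConnectedSpace X] (hW : IsOpen W) {l : ℝ → X}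
    (hl : Continuous l) (hfin : {t ∈ Set.Ioo (0 : ℝ) 1 | l t ∉ W}.Finite) (F : Finset (Set X))
    (hF : ∀ A ∈ F, IsComponentOf W A) (hne : ∀ A ∈ F, ∃ t ∈ Set.Ioo (0 : ℝ) 1, l t ∈ A) :
    F.card ≤ {t ∈ Set.Ioo (0 : ℝ) 1 | l t ∉ W}.ncard + 1 := by
  choose! f hf using fun A hA => (hF A hA).exists_top hW hl hfin (hne A hA)
  rw [← Set.ncard_coe_finset F]
  refine (Set.ncard_le_ncard_of_injOn (t := insert 1 {t ∈ Set.Ioo (0 : ℝ) 1 | l t ∉ W})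
    f ?_ ?_ (hfin.insert 1)).trans (Set.ncard_insert_le _ _)
  · intro A hA
    exact (hf A hA).2.2.2.2
  · intro A hA B hB hAB
    refine (hF A hA).eq_of_eventually_mem_left (hF B hB) (hf A hA).2.2.1 ?_
    rw [hAB]
    exact (hf B hB).2.2.1

/-- If no parameter is both the last one in some component of a family and the first one in another,
a path meets at most half as many components of the family as it has exit parameters. -/
theorem two_mul_card_le_ncard [LocallyConnectedSpace X] (hW : IsOpen W) {l : ℝ → X}
    (hl : Continuous l) (hfin : {t ∈ Set.Ioo (0 : ℝ) 1 | l t ∉ W}.Finite) (F : Finset (Set X))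
    (hF : ∀ A ∈ F, IsComponentOf W A) (hne : ∀ A ∈ F, ∃ t ∈ Set.Ioo (0 : ℝ) 1, l t ∈ A)
    (h0 : ∀ A ∈ F, l 0 ∉ closure A) (h1 : ∀ A ∈ F, l 1 ∉ closure A)
    (hsep : ∀ A ∈ F, ∀ B ∈ F, A ≠ B → ∀ t ∈ Set.Ioo (0 : ℝ) 1,
      l t ∈ closure A → l t ∈ closure B →
      (∀ s ∈ Set.Ioo (0 : ℝ) 1, l s ∈ A → s < t) → (∃ t' < t, ∀ s ∈ Set.Ioo t' t, l s ∈ A) →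
      (∀ s ∈ Set.Ioo (0 : ℝ) 1, l s ∈ B → t < s) → (∃ t' > t, ∀ s ∈ Set.Ioo t t', l s ∈ B) →
      False) :
    2 * F.card ≤ {t ∈ Set.Ioo (0 : ℝ) 1 | l t ∉ W}.ncard := by
  choose! f hf using fun A hA => (hF A hA).exists_top hW hl hfin (hne A hA)
  choose! g hg using fun A hA => (hF A hA).exists_bot hW hl hfin (hne A hA)
  have hfP : ∀ A ∈ F, f A ∈ {t ∈ Set.Ioo (0 : ℝ) 1 | l t ∉ W} := by
    intro A hA
    refine (hf A hA).2.2.2.2.resolve_left fun h => h1 A hA ?_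
    rw [← h]
    exact (hf A hA).2.2.2.1
  have hgP : ∀ A ∈ F, g A ∈ {t ∈ Set.Ioo (0 : ℝ) 1 | l t ∉ W} := by
    intro A hA
    refine (hg A hA).2.2.2.2.resolve_left fun h => h0 A hA ?_
    rw [← h]
    exact (hg A hA).2.2.2.1
  have hfi : Set.InjOn f F := by
    intro A hA B hB hAB
    refine (hF A hA).eq_of_eventually_mem_left (hF B hB) (hf A hA).2.2.1 ?_
    rw [hAB]
    exact (hf B hB).2.2.1
  have hgi : Set.InjOn g F := by
    intro A hA B hB hAB
    refine (hF A hA).eq_of_eventually_mem_right (hF B hB) (hg A hA).2.2.1 ?_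
    rw [hAB]
    exact (hg B hB).2.2.1
  have hdisj : Disjoint (f '' F) (g '' F) := by
    rw [Set.disjoint_left]
    rintro _ ⟨A, hA, rfl⟩ ⟨B, hB, hBA⟩
    have hB' := hg B hB
    rw [hBA] at hB'
    by_cases hAB : A = B
    · subst hAB
      obtain ⟨s, hs, hsA⟩ := hne A hA
      exact lt_asymm ((hf A hA).2.1 s hs hsA) (hB'.2.1 s hs hsA)
    · exact hsep A hA B hB hAB _ (hfP A hA).1 (hf A hA).2.2.2.1 hB'.2.2.2.1 (hf A hA).2.1
        (hf A hA).2.2.1 hB'.2.1 hB'.2.2.1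
  have hfc : (f '' F).ncard = F.card := by
    rw [hfi.ncard_image, Set.ncard_coe_finset]
  have hgc : (g '' F).ncard = F.card := by
    rw [hgi.ncard_image, Set.ncard_coe_finset]
  calc 2 * F.card = (f '' F ∪ g '' F).ncard := by
        rw [Set.ncard_union_eq hdisj (F.finite_toSet.image f) (F.finite_toSet.image g), hfc, hgc]
        ring
    _ ≤ _ := by
        refine Set.ncard_le_ncard ?_ hfin
        rintro _ (⟨A, hA, rfl⟩ | ⟨A, hA, rfl⟩)
        exacts [hfP A hA, hgP A hA]

end IsComponentOf

/-- A nowhere vanishing continuous complex function on the plane has a continuous square root. -/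
theorem exists_continuous_sq_eq {w : ℝ × ℝ → ℂ} (hw : Continuous w) (h0 : ∀ q, w q ≠ 0) :
    ∃ v : ℝ × ℝ → ℂ, Continuous v ∧ ∀ q, v q ^ 2 = w q := by
  obtain ⟨F, ⟨-, hF⟩, -⟩ := Complex.isCoveringMapOn_exp.existsUnique_continuousMap_lifts
    ⟨w, hw⟩ (a₀ := (0, 0)) (e₀ := Complex.log (w (0, 0))) (Complex.exp_log (h0 _)) h0
  refine ⟨fun q => Complex.exp (F q / 2), by fun_prop, fun q => ?_⟩
  have := congrFun hF q
  rw [← Complex.exp_nat_mul]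
  simp only [Function.comp_apply, ContinuousMap.coe_mk] at this
  rw [← this]
  congr 1
  push_cast
  ring

/-- If `γ` is a closed relatively open part of the zero set of `φ`, there is a continuous function
vanishing exactly on `γ` that agrees with `φ` up to sign near each point of `γ`. -/
theorem exists_continuous_eq_or_eq_neg {φ : ℝ × ℝ → ℝ} (hφ : Continuous φ) {γ O : Set (ℝ × ℝ)}
    (hγ : IsClosed γ) (hne : γ.Nonempty) (hO : IsOpen O) (hOne : Oᶜ.Nonempty) (hγO : γ ⊆ O)
    (hz : ∀ q ∈ γ, φ q = 0) (hOz : ∀ q ∈ O, φ q = 0 → q ∈ γ) :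
    ∃ r : ℝ × ℝ → ℝ, Continuous r ∧ (∀ q, r q = 0 ↔ q ∈ γ) ∧
      ∀ q ∈ γ, (∀ᶠ z in nhds q, r z = φ z) ∨ (∀ᶠ z in nhds q, r z = -φ z) := by
  set τ : ℝ × ℝ → ℝ := fun q => Metric.infDist q γ - Metric.infDist q Oᶜ with hτ
  have hτc : Continuous τ := (Metric.continuous_infDist_pt _).sub (Metric.continuous_infDist_pt _)
  have hτO : ∀ q, τ q < 0 → q ∈ O := by
    intro q hq
    by_contra hqO
    have : Metric.infDist q Oᶜ = 0 := Metric.infDist_zero_of_mem hqO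
    have := Metric.infDist_nonneg (x := q) (s := γ)
    simp only [hτ] at hq
    linarith
  have hτγ : ∀ q ∈ γ, τ q < 0 := by
    intro q hq
    have h1 : Metric.infDist q γ = 0 := Metric.infDist_zero_of_mem hq
    have h2 : 0 < Metric.infDist q Oᶜ :=
      (hO.isClosed_compl.notMem_iff_infDist_pos hOne).1 (fun h => h (hγO hq))
    simp only [hτ]
    linarith
  have hτ0 : ∀ q, τ q = 0 → φ q ≠ 0 := by
    intro q hq h0
    have hqO : q ∈ O := by
      by_contra hqO
      have h1 : Metric.infDist q Oᶜ = 0 := Metric.infDist_zero_of_mem hqO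
      have h2 : q ∈ γ := (hγ.mem_iff_infDist_zero hne).2 (by simp only [hτ] at hq; linarith)
      exact hqO (hγO h2)
    exact (hτγ q (hOz q hqO h0)).ne hq
  set w : ℝ × ℝ → ℂ := fun q =>
    ((φ q : ℂ) - (max 0 (-τ q) : ℝ) * Complex.I) ^ 2 + (max 0 (τ q) : ℝ) with hw
  have hneg : ∀ q, τ q < 0 → w q = ((φ q : ℂ) - (-τ q : ℝ) * Complex.I) ^ 2 := by
    intro q hq
    simp only [hw]
    rw [max_eq_right (by linarith : 0 ≤ -τ q), max_eq_left hq.le]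
    simp
  have hpos : ∀ q, 0 ≤ τ q → w q = ((φ q ^ 2 + τ q : ℝ) : ℂ) ∧ 0 < φ q ^ 2 + τ q := by
    intro q hq
    constructor
    · simp only [hw]
      rw [max_eq_left (by linarith : -τ q ≤ 0), max_eq_right hq]
      push_cast
      ring
    · rcases hq.eq_or_lt with h | h
      · have := hτ0 q h.symm
        positivity
      · positivity
  have hw0 : ∀ q, w q ≠ 0 := by
    intro q
    rcases lt_or_ge (τ q) 0 with h | h
    · rw [hneg q h]
      refine pow_ne_zero _ fun h' => ?_
      have := congrArg Complex.im h'
      simp at this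
      linarith
    · rw [(hpos q h).1]
      exact_mod_cast (hpos q h).2.ne'
  obtain ⟨v, hv, hvw⟩ := exists_continuous_sq_eq (by fun_prop : Continuous w) hw0
  have hcases : ∀ q, τ q < 0 → v q = (φ q : ℂ) - (-τ q : ℝ) * Complex.I ∨
      v q = -((φ q : ℂ) - (-τ q : ℝ) * Complex.I) := fun q hq =>
    sq_eq_sq_iff_eq_or_eq_neg.1 ((hvw q).trans (hneg q hq))
  refine ⟨fun q => (v q).re, by fun_prop, fun q => ⟨fun h => ?_, fun h => ?_⟩, fun q hq => ?_⟩
  · replace h : (v q).re = 0 := h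
    rcases lt_or_ge (τ q) 0 with ht | ht
    · refine hOz q (hτO q ht) ?_
      rcases hcases q ht with h' | h' <;> rw [h'] at h <;> simpa using h
    · exfalso
      have h1 := congrArg Complex.re ((hvw q).trans (hpos q ht).1)
      rw [sq, Complex.mul_re, h, Complex.ofReal_re] at h1
      nlinarith [(hpos q ht).2]
  · rcases hcases q (hτγ q h) with h' | h' <;> simp [h', hz q h]
  · have hev : ∀ᶠ z in nhds q, τ z < 0 := hτc.continuousAt.eventually_lt_const (hτγ q hq)
    have him : Continuous fun z => (v z).im := by fun_prop
    rcases hcases q (hτγ q hq) with h' | h'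
    · left
      have h1 : (v q).im < 0 := by rw [h']; simpa using hτγ q hq
      filter_upwards [hev, him.continuousAt.eventually_lt_const h1] with z hz1 hz2
      rcases hcases z hz1 with h | h
      · simp [h]
      · rw [h] at hz2
        simp at hz2
        linarith
    · right
      have h1 : 0 < (v q).im := by rw [h']; simpa using hτγ q hq
      filter_upwards [hev, him.continuousAt.eventually_const_lt h1] with z hz1 hz2
      rcases hcases z hz1 with h | h
      · rw [h] at hz2
        simp at hz2
        linarith
      · simp [h]

/-- Near a nonsingular zero of a `C¹` function the positive and the negative set are connected, and
every nearby zero is a limit of both. -/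
theorem exists_nhds_isPreconnected_pos_neg {φ : ℝ × ℝ → ℝ} (hφ : ContDiff ℝ 1 φ) {q : ℝ × ℝ}
    {O : Set (ℝ × ℝ)} (hO : IsOpen O) (hqO : q ∈ O) (hd : fderiv ℝ φ q ≠ 0) :
    ∃ V : Set (ℝ × ℝ), IsOpen V ∧ q ∈ V ∧ V ⊆ O ∧
      IsPreconnected (V ∩ {z | 0 < φ z}) ∧ IsPreconnected (V ∩ {z | φ z < 0}) ∧
      ∀ z ∈ V, φ z = 0 → z ∈ closure (V ∩ {z | 0 < φ z}) ∧ z ∈ closure (V ∩ {z | φ z < 0}) := by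
  have hs : HasStrictFDerivAt φ (fderiv ℝ φ q) q :=
    hφ.contDiffAt.hasStrictFDerivAt one_ne_zero
  have hr : (fderiv ℝ φ q).range = ⊤ := by
    apply LinearMap.range_eq_top.2
    apply LinearMap.surjective
    intro h
    exact hd (ContinuousLinearMap.coe_injective h)
  set e := hs.implicitToOpenPartialHomeomorph φ _ hr with he
  have hfst : ∀ z, (e z).1 = φ z := fun z => hs.implicitToOpenPartialHomeomorph_fst hr z
  have hqs : q ∈ e.source := hs.mem_implicitToOpenPartialHomeomorph_source hr
  obtain ⟨ε, hε, hBO⟩ := Metric.isOpen_iff.1 (e.isOpen_inter_preimage_symm hO) (e q)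
    ⟨e.map_source hqs, by simpa [e.left_inv hqs] using hqO⟩
  set B := Metric.ball (e q) ε
  have hB : B ⊆ e.target := hBO.trans Set.inter_subset_left
  have himg : ∀ S : Set ℝ, (e.source ∩ e ⁻¹' B) ∩ {z | φ z ∈ S} =
      e.symm '' (B ∩ {t | t.1 ∈ S}) := by
    intro S
    ext z
    constructor
    · rintro ⟨⟨h1, h2⟩, h3⟩
      exact ⟨e z, ⟨h2, by simpa [hfst] using h3⟩, e.left_inv h1⟩
    · rintro ⟨t, ⟨h1, h2⟩, rfl⟩
      refine ⟨⟨e.map_target (hB h1), ?_⟩, ?_⟩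
      · simpa [e.right_inv (hB h1)] using h1
      · have := hfst (e.symm t)
        rw [e.right_inv (hB h1)] at this
        simpa [← this] using h2
  have hconn : ∀ S : Set ℝ, Convex ℝ S →
      IsPreconnected ((e.source ∩ e ⁻¹' B) ∩ {z | φ z ∈ S}) := by
    intro S hS
    rw [himg S]
    apply IsPreconnected.image
    · exact ((convex_ball _ _).inter (hS.linear_preimage (LinearMap.fst ℝ ℝ _))).isPreconnected
    · exact e.continuousOn_symm.mono (Set.inter_subset_left.trans hB)
  have hlim : ∀ (S : Set ℝ) (z : ℝ × ℝ), z ∈ e.source ∩ e ⁻¹' B → φ z ∈ closure S →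
      z ∈ closure ((e.source ∩ e ⁻¹' B) ∩ {z | φ z ∈ S}) := by
    intro S z hz hzS
    rw [himg S]
    have h1 : e z ∈ closure (B ∩ {t | t.1 ∈ S}) := by
      refine Metric.isOpen_ball.inter_closure ⟨hz.2, ?_⟩
      have : {t : ℝ × (fderiv ℝ φ q).ker | t.1 ∈ S} = S ×ˢ Set.univ := by
        ext; simp
      rw [this, closure_prod_eq]
      exact ⟨by simpa [hfst] using hzS, by simp⟩
    rw [← e.left_inv hz.1]
    have hc : ContinuousWithinAt e.symm (B ∩ {t | t.1 ∈ S}) (e z) :=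
      (e.continuousAt_symm (e.map_source hz.1)).continuousWithinAt
    exact hc.mem_closure_image h1
  refine ⟨e.source ∩ e ⁻¹' B, e.isOpen_inter_preimage Metric.isOpen_ball,
    ⟨hqs, Metric.mem_ball_self hε⟩,
    fun z hz => by simpa [e.left_inv hz.1] using (hBO hz.2).2, hconn (Set.Ioi 0) (convex_Ioi 0), hconn (Set.Iio 0)
    (convex_Iio 0), fun z hz h0 => ⟨hlim (Set.Ioi 0) z hz ?_, hlim (Set.Iio 0) z hz ?_⟩⟩
  · simp [h0]
  · simp [h0]

/-- A function on an interval whose zeros are isolated and which is locally of one sign near each of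
its zeros is of one sign. -/
theorem IsPreconnected.nonneg_or_nonpos {I : Set ℝ} (hI : IsPreconnected I) {u : ℝ → ℝ}
    (hu : ∀ s ∈ I, (∀ᶠ z in nhds s, 0 ≤ u z) ∨ (∀ᶠ z in nhds s, u z ≤ 0))
    (hd : ∀ s, ¬ ∀ᶠ z in nhds s, u z = 0) :
    (∀ s ∈ I, 0 ≤ u s) ∨ (∀ s ∈ I, u s ≤ 0) := by
  set P : Set ℝ := {s | ∀ᶠ z in nhds s, 0 ≤ u z}
  set N : Set ℝ := {s | ∀ᶠ z in nhds s, u z ≤ 0}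
  have hP : IsOpen P := isOpen_setOfPred_eventually_nhds
  have hN : IsOpen N := isOpen_setOfPred_eventually_nhds
  have hPN : Disjoint P N := by
    rw [Set.disjoint_left]
    intro s h1 h2
    refine hd s ?_
    filter_upwards [h1, h2] with z h3 h4
    exact le_antisymm h4 h3
  rcases hI.subset_or_subset hP hN hPN hu with h | h
  · exact Or.inl fun s hs => (show ∀ᶠ z in nhds s, 0 ≤ u z from h hs).self_of_nhds
  · exact Or.inr fun s hs => (show ∀ᶠ z in nhds s, u z ≤ 0 from h hs).self_of_nhds

/-- A continuous function without zeros on the boundary of the unit square takes values of the same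
sign at the two ends of each vertical segment. -/
theorem mul_pos_of_ne_zero_on_frontier {r : ℝ × ℝ → ℝ} (hr : Continuous r)
    (h0 : ∀ q, q ∉ Set.Ioo (0 : ℝ) 1 ×ˢ Set.Ioo (0 : ℝ) 1 → r q ≠ 0) (c : ℝ) :
    0 < r (c, 0) * r (c, 1) := by
  have key : ∀ {S : Set (ℝ × ℝ)}, IsPreconnected S → (∀ q ∈ S, r q ≠ 0) → ∀ x ∈ S, ∀ y ∈ S,
      0 < r x * r y := by
    intro S hS hS0 x hx y hy
    by_contra hneg
    have hmem : (0 : ℝ) ∈ r '' S := by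
      have hconn := (hS.image r hr.continuousOn).ordConnected
      have hx' := Set.mem_image_of_mem r hx
      have hy' := Set.mem_image_of_mem r hy
      rcases lt_or_gt_of_ne (hS0 x hx) with h1 | h1 <;> rcases lt_or_gt_of_ne (hS0 y hy) with h2 | h2
      · exact absurd (mul_pos_of_neg_of_neg h1 h2) hneg
      · exact hconn.out hx' hy' ⟨h1.le, h2.le⟩
      · exact hconn.out hy' hx' ⟨h2.le, h1.le⟩
      · exact absurd (mul_pos h1 h2) hneg
    obtain ⟨q, hq, hq0⟩ := hmem
    exact hS0 q hq hq0
  have h1 : IsPreconnected ((Set.univ : Set ℝ) ×ˢ ({0} : Set ℝ)) :=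
    isPreconnected_univ.prod isPreconnected_singleton
  have h2 : IsPreconnected (({0} : Set ℝ) ×ˢ (Set.univ : Set ℝ)) :=
    isPreconnected_singleton.prod isPreconnected_univ
  have h3 : IsPreconnected ((Set.univ : Set ℝ) ×ˢ ({1} : Set ℝ)) :=
    isPreconnected_univ.prod isPreconnected_singleton
  refine key ((h1.union (0, 0) (by simp) (by simp) h2).union (0, 1) (by simp) (by simp) h3) ?_
    (c, 0) (by simp) (c, 1) (by simp)
  rintro ⟨x, y⟩ ((h | h) | h) <;> refine h0 _ ?_ <;> simp at h <;> simp [h]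

/-- Two nodal domains that are relatively compact in the open unit square cannot be separated on a
vertical line by a single common boundary point. -/
theorem false_of_separated_of_pos {φ : ℝ × ℝ → ℝ} {W A B : Set (ℝ × ℝ)} (hφ : ContDiff ℝ 1 φ)
    (hW : W = {q | q ∈ Set.Ioo (0 : ℝ) 1 ×ˢ Set.Ioo (0 : ℝ) 1 ∧ φ q ≠ 0})
    (hns : ∀ p ∈ Set.Ioo (0 : ℝ) 1 ×ˢ Set.Ioo (0 : ℝ) 1, φ p = 0 → fderiv ℝ φ p ≠ 0)
    (hA : IsComponentOf W A) (hB : IsComponentOf W B) (hAB : A ≠ B)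
    (hAR : closure A ⊆ Set.Ioo (0 : ℝ) 1 ×ˢ Set.Ioo (0 : ℝ) 1) {c t : ℝ}
    (ht : t ∈ Set.Ioo (0 : ℝ) 1)
    (hfin : {s ∈ Set.Ioo (0 : ℝ) 1 | φ (c, s) = 0}.Finite)
    (htA : (c, t) ∈ closure A) (htB : (c, t) ∈ closure B)
    (hlt : ∀ s ∈ Set.Ioo (0 : ℝ) 1, (c, s) ∈ A → s < t)
    (hnear : ∃ t' < t, ∀ s ∈ Set.Ioo t' t, (c, s) ∈ A)
    (hgt : ∀ s ∈ Set.Ioo (0 : ℝ) 1, (c, s) ∈ B → t < s)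
    (hnear' : ∃ t' > t, ∀ s ∈ Set.Ioo t t', (c, s) ∈ B)
    (hpos : ∃ q ∈ A, 0 < φ q) : False := by
  have hR : IsOpen (Set.Ioo (0 : ℝ) 1 ×ˢ Set.Ioo (0 : ℝ) 1) := isOpen_Ioo.prod isOpen_Ioo
  have hWo : IsOpen W := by
    rw [hW]
    exact hR.inter (isOpen_ne_fun hφ.continuous continuous_const)
  have hApos : ∀ q ∈ A, 0 < φ q := by
    intro q hq
    by_contra hneg
    obtain ⟨q₀, hq₀, hpos⟩ := hpos
    obtain ⟨z, hz, hz0⟩ := (hA.isPreconnected.image φ hφ.continuous.continuousOn).ordConnected.out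
      ⟨q, hq, rfl⟩ ⟨q₀, hq₀, rfl⟩ ⟨not_lt.1 hneg, hpos.le⟩
    have := hA.subset hz
    rw [hW] at this
    exact this.2 hz0
  set γ := closure A ∩ closure B with hγ
  have hγ0 : ∀ q ∈ γ, φ q = 0 := by
    intro q hq
    by_contra h0
    have hqW : q ∈ W := by
      rw [hW]
      exact ⟨hAR hq.1, h0⟩
    exact hAB (hA.eq_of_mem hB (hA.closure_inter_subset hWo ⟨hq.1, hqW⟩)
      (hB.closure_inter_subset hWo ⟨hq.2, hqW⟩))
  have hloc : ∀ q ∈ γ, ∃ V : Set (ℝ × ℝ), IsOpen V ∧ q ∈ V ∧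
      V ⊆ Set.Ioo (0 : ℝ) 1 ×ˢ Set.Ioo (0 : ℝ) 1 ∧ V ∩ {z | 0 < φ z} ⊆ A ∧
      V ∩ {z | φ z < 0} ⊆ B ∧ ∀ z ∈ V, φ z = 0 → z ∈ γ := by
    intro q hq
    obtain ⟨V, hV, hqV, hVR, hVp, hVn, hVc⟩ := exists_nhds_isPreconnected_pos_neg hφ hR
      (hAR hq.1) (hns q (hAR hq.1) (hγ0 q hq))
    have hpW : V ∩ {z | 0 < φ z} ⊆ W := by
      rw [hW]
      exact fun z hz => ⟨hVR hz.1, ne_of_gt hz.2⟩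
    have hnW : V ∩ {z | φ z < 0} ⊆ W := by
      rw [hW]
      exact fun z hz => ⟨hVR hz.1, ne_of_lt hz.2⟩
    have h1 : V ∩ {z | 0 < φ z} ⊆ A := by
      obtain ⟨x, hxV, hxA⟩ := mem_closure_iff.1 hq.1 V hV hqV
      exact hA.subset_of_isPreconnected hVp hpW ⟨x, ⟨hxV, hApos x hxA⟩, hxA⟩
    have h2 : V ∩ {z | φ z < 0} ⊆ B := by
      obtain ⟨x, hxV, hxB⟩ := mem_closure_iff.1 hq.2 V hV hqV
      have hx0 : φ x ≠ 0 := by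
        have := hB.subset hxB
        rw [hW] at this
        exact this.2
      rcases lt_or_gt_of_ne hx0 with h | h
      · exact hB.subset_of_isPreconnected hVn hnW ⟨x, ⟨hxV, h⟩, hxB⟩
      · exact absurd (hA.eq_of_mem hB (h1 ⟨hxV, h⟩) hxB) hAB
    exact ⟨V, hV, hqV, hVR, h1, h2, fun z hz hz0 =>
      ⟨closure_mono h1 (hVc z hz hz0).1, closure_mono h2 (hVc z hz hz0).2⟩⟩
  choose! V hV hqV hVR hVA hVB hVγ using hloc
  obtain ⟨r, hr, hr0, hrφ⟩ := exists_continuous_eq_or_eq_neg (γ := γ) (O := ⋃ q ∈ γ, V q)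
    hφ.continuous (isClosed_closure.inter isClosed_closure) ⟨(c, t), htA, htB⟩
    (isOpen_biUnion hV) ⟨(0, 0), by
      simp only [Set.mem_compl_iff, Set.mem_iUnion, not_exists]
      intro q hq h
      simpa using hVR q hq h⟩
    (fun q hq => Set.mem_biUnion hq (hqV q hq)) hγ0 (by
      intro z hz hz0
      obtain ⟨q, hq, hz⟩ := Set.mem_iUnion₂.1 hz
      exact hVγ q hq z hz hz0)
  have hcont : Continuous fun s : ℝ => ((c, s) : ℝ × ℝ) := by fun_prop
  have hd : ∀ s, ¬ ∀ᶠ z in nhds s, r (c, z) = 0 := by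
    intro s hs
    refine infinite_of_mem_nhds s hs (hfin.subset fun z hz => ?_)
    have hz' := (hr0 _).1 hz
    exact ⟨(hAR hz'.1).2, hγ0 _ hz'⟩
  have hsign : ∀ I : Set ℝ, IsPreconnected I → (∀ s ∈ I, (c, s) ∈ γ →
      (∀ᶠ z in nhds s, 0 ≤ φ (c, z)) ∨ (∀ᶠ z in nhds s, φ (c, z) ≤ 0)) →
      (∀ s ∈ I, 0 ≤ r (c, s)) ∨ (∀ s ∈ I, r (c, s) ≤ 0) := by
    intro I hI h
    refine hI.nonneg_or_nonpos (fun s hs => ?_) hd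
    have hrc : ContinuousAt (fun s => r (c, s)) s := (hr.comp hcont).continuousAt
    rcases lt_trichotomy (r (c, s)) 0 with h1 | h1 | h1
    · exact Or.inr ((hrc.eventually_lt_const h1).mono fun _ h => h.le)
    · have hsγ := (hr0 _).1 h1
      rcases hrφ _ hsγ with h2 | h2 <;> rcases h s hs hsγ with h3 | h3
      · left
        filter_upwards [hcont.continuousAt.eventually h2, h3] with z h4 h5
        rwa [h4]
      · right
        filter_upwards [hcont.continuousAt.eventually h2, h3] with z h4 h5
        rwa [h4]
      · right
        filter_upwards [hcont.continuousAt.eventually h2, h3] with z h4 h5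
        rw [h4]
        linarith
      · left
        filter_upwards [hcont.continuousAt.eventually h2, h3] with z h4 h5
        rw [h4]
        linarith
    · exact Or.inl ((hrc.eventually_const_lt h1).mono fun _ h => h.le)
  have hup := hsign (Set.Ioi t) isPreconnected_Ioi (by
    intro s hs hsγ
    right
    filter_upwards [lt_mem_nhds hs, hcont.continuousAt.eventually
      ((hV _ hsγ).mem_nhds (hqV _ hsγ))] with z hz hzV
    by_contra hzpos
    exact lt_asymm hz (hlt z (hVR _ hsγ hzV).2 (hVA _ hsγ ⟨hzV, not_le.1 hzpos⟩)))
  have hdown := hsign (Set.Iio t) isPreconnected_Iio (by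
    intro s hs hsγ
    left
    filter_upwards [gt_mem_nhds hs, hcont.continuousAt.eventually
      ((hV _ hsγ).mem_nhds (hqV _ hsγ))] with z hz hzV
    by_contra hzneg
    exact lt_asymm hz (hgt z (hVR _ hsγ hzV).2 (hVB _ hsγ ⟨hzV, not_le.1 hzneg⟩)))
  have hprod := mul_pos_of_ne_zero_on_frontier hr
    (fun q hq h => hq (hAR ((hr0 q).1 h).1)) c
  have htγ : (c, t) ∈ γ := ⟨htA, htB⟩
  have hclose : ∀ᶠ z in nhds t, (c, z) ∈ V (c, t) ∧ (r (c, z) = φ (c, z) ∨ r (c, z) = -φ (c, z)) := by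
    have h1 := hcont.continuousAt.eventually ((hV _ htγ).mem_nhds (hqV _ htγ))
    rcases hrφ _ htγ with h2 | h2
    · filter_upwards [h1, hcont.continuousAt.eventually h2] with z h3 h4
      exact ⟨h3, Or.inl h4⟩
    · filter_upwards [h1, hcont.continuousAt.eventually h2] with z h3 h4
      exact ⟨h3, Or.inr h4⟩
  obtain ⟨a, ha, haA⟩ := hnear
  obtain ⟨b, hb, hbB⟩ := hnear'
  have hBneg : ∀ z ∈ V (c, t), z ∈ B → φ z < 0 := by
    intro z hz hzB
    have hz0 : φ z ≠ 0 := by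
      have := hB.subset hzB
      rw [hW] at this
      exact this.2
    refine lt_of_le_of_ne (not_lt.1 fun hzp => hAB ?_) hz0
    exact hA.eq_of_mem hB (hVA _ htγ ⟨hz, hzp⟩) hzB
  have hbelow : ∀ᶠ z in nhds t, z < t → 0 < φ (c, z) := by
    filter_upwards [lt_mem_nhds ha] with z hz hzt
    exact hApos _ (haA z ⟨hz, hzt⟩)
  have habove : ∀ᶠ z in nhds t, t < z → φ (c, z) < 0 := by
    filter_upwards [gt_mem_nhds hb, hclose] with z hz hz' hzt
    exact hBneg _ hz'.1 (hbB z ⟨hzt, hz⟩)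
  have hex : ∀ p : ℝ → Prop, (∀ᶠ z in nhds t, p z) → (∃ z < t, p z) ∧ (∃ z > t, p z) := by
    intro p hp
    exact ⟨((hp.filter_mono nhdsWithin_le_nhds).and self_mem_nhdsWithin :
      ∀ᶠ z in nhdsWithin t (Set.Iio t), p z ∧ z < t).exists.imp fun _ h => ⟨h.2, h.1⟩,
      ((hp.filter_mono nhdsWithin_le_nhds).and self_mem_nhdsWithin :
      ∀ᶠ z in nhdsWithin t (Set.Ioi t), p z ∧ t < z).exists.imp fun _ h => ⟨h.2, h.1⟩⟩
  rcases hrφ _ htγ with h2 | h2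
  · obtain ⟨⟨z, hz, hz1, hz2, -⟩, ⟨y, hy, hy1, -, hy2⟩⟩ :=
      hex _ ((hcont.continuousAt.eventually h2).and (hbelow.and habove))
    have hz3 := hz2 hz
    have hy3 := hy2 hy
    have e1 : 0 ≤ r (c, 0) := by
      rcases hdown with h | h
      · exact h 0 ht.1
      · exact absurd (h z hz) (by rw [hz1]; exact not_le.2 hz3)
    have e2 : r (c, 1) ≤ 0 := by
      rcases hup with h | h
      · exact absurd (h y hy) (by rw [hy1]; exact not_le.2 hy3)
      · exact h 1 ht.2
    nlinarith
  · obtain ⟨⟨z, hz, hz1, hz2, -⟩, ⟨y, hy, hy1, -, hy2⟩⟩ :=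
      hex _ ((hcont.continuousAt.eventually h2).and (hbelow.and habove))
    have hz3 := hz2 hz
    have hy3 := hy2 hy
    have e1 : r (c, 0) ≤ 0 := by
      rcases hdown with h | h
      · exact absurd (h z hz) (by rw [hz1]; linarith)
      · exact h 0 ht.1
    have e2 : 0 ≤ r (c, 1) := by
      rcases hup with h | h
      · exact h 1 ht.2
      · exact absurd (h y hy) (by rw [hy1]; linarith)
    nlinarith

theorem false_of_separated {φ : ℝ × ℝ → ℝ} {W A B : Set (ℝ × ℝ)} (hφ : ContDiff ℝ 1 φ)
    (hW : W = {q | q ∈ Set.Ioo (0 : ℝ) 1 ×ˢ Set.Ioo (0 : ℝ) 1 ∧ φ q ≠ 0})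
    (hns : ∀ p ∈ Set.Ioo (0 : ℝ) 1 ×ˢ Set.Ioo (0 : ℝ) 1, φ p = 0 → fderiv ℝ φ p ≠ 0)
    (hA : IsComponentOf W A) (hB : IsComponentOf W B) (hAB : A ≠ B)
    (hAR : closure A ⊆ Set.Ioo (0 : ℝ) 1 ×ˢ Set.Ioo (0 : ℝ) 1) {c t : ℝ}
    (ht : t ∈ Set.Ioo (0 : ℝ) 1)
    (hfin : {s ∈ Set.Ioo (0 : ℝ) 1 | φ (c, s) = 0}.Finite)
    (htA : (c, t) ∈ closure A) (htB : (c, t) ∈ closure B)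
    (hlt : ∀ s ∈ Set.Ioo (0 : ℝ) 1, (c, s) ∈ A → s < t)
    (hnear : ∃ t' < t, ∀ s ∈ Set.Ioo t' t, (c, s) ∈ A)
    (hgt : ∀ s ∈ Set.Ioo (0 : ℝ) 1, (c, s) ∈ B → t < s)
    (hnear' : ∃ t' > t, ∀ s ∈ Set.Ioo t t', (c, s) ∈ B) : False := by
  obtain ⟨q, hq⟩ := hA.nonempty
  have hq0 : φ q ≠ 0 := by
    have := hA.subset hq
    rw [hW] at this
    exact this.2
  rcases lt_or_gt_of_ne hq0 with h | h
  · refine false_of_separated_of_pos (φ := -φ) hφ.neg (by simpa using hW) (fun p hp hp0 => ?_) hA hB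
      hAB hAR ht (by simpa using hfin) htA htB hlt hnear hgt hnear' ⟨q, hq, by simpa using h⟩
    rw [fderiv_neg, neg_ne_zero]
    exact hns p hp (by simpa using hp0)
  · exact false_of_separated_of_pos hφ hW hns hA hB hAB hAR ht hfin htA htB hlt hnear hgt hnear'
      ⟨q, hq, h⟩

theorem IsLocalMax.deriv_deriv_nonpos {f : ℝ → ℝ} {x : ℝ} (h : IsLocalMax f x)
    (hf : ContinuousAt f x) : deriv (deriv f) x ≤ 0 := by
  by_contra hpos
  have hmin := isLocalMin_of_deriv_deriv_pos (not_le.1 hpos) h.deriv_eq_zero hf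
  have heq : f =ᶠ[nhds x] fun _ => f x := by
    filter_upwards [h, hmin] with z h1 h2
    exact le_antisymm h1 h2
  have := heq.deriv.deriv_eq
  simp at this
  exact hpos this.le

/-- A positive nodal domain with eigenvalue `λ` is not contained in a vertical strip of width less
than `π / √λ`. -/
theorem pi_le_of_subset_strip_of_pos {φ : ℝ × ℝ → ℝ} {lam : ℝ} {W A : Set (ℝ × ℝ)}
    (hφ : ContDiff ℝ 2 φ)
    (hlap : ∀ p ∈ Set.Icc (0 : ℝ) 1 ×ˢ Set.Icc (0 : ℝ) 1, laplacian2 φ p = -lam * φ p)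
    (hbd : ∀ p ∈ frontier (Set.Icc (0 : ℝ) 1 ×ˢ Set.Icc (0 : ℝ) 1), φ p = 0)
    (hW : W = {q | q ∈ Set.Ioo (0 : ℝ) 1 ×ˢ Set.Ioo (0 : ℝ) 1 ∧ φ q ≠ 0})
    (hA : IsComponentOf W A) {α β : ℝ} (hstrip : ∀ q ∈ A, q.1 ∈ Set.Ioo α β)
    (hpos : ∃ q ∈ A, 0 < φ q) : π ≤ (β - α) * √lam := by
  by_contra hlt
  rw [not_le] at hlt
  obtain ⟨q₀, hq₀, hpos⟩ := hpos
  have hR : IsOpen (Set.Ioo (0 : ℝ) 1 ×ˢ Set.Ioo (0 : ℝ) 1) := isOpen_Ioo.prod isOpen_Ioo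
  have hWo : IsOpen W := by
    rw [hW]
    exact hR.inter (isOpen_ne_fun hφ.continuous continuous_const)
  have hαβ : 0 < β - α := by
    have := hstrip q₀ hq₀
    linarith [this.1, this.2]
  obtain ⟨μ, hμ1, hμ2⟩ : ∃ μ, √lam < μ ∧ μ < π / (β - α) :=
    exists_between (by rw [lt_div_iff₀ hαβ]; linarith)
  rw [lt_div_iff₀ hαβ] at hμ2
  have hμ0 : 0 < μ := (Real.sqrt_nonneg _).trans_lt hμ1
  have hμlam : lam < μ ^ 2 := Real.lt_sq_of_sqrt_lt hμ1
  set m := (α + β) / 2 with hm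
  have hcos : ∀ x ∈ Set.Icc α β, 0 < cos (μ * (x - m)) := by
    intro x hx
    apply Real.cos_pos_of_mem_Ioo
    constructor <;> nlinarith [hx.1, hx.2]
  have hKs : ∀ q ∈ closure A, q.1 ∈ Set.Icc α β := by
    refine closure_minimal (fun q hq => Set.Ioo_subset_Icc_self (hstrip q hq))
      (isClosed_Icc.preimage continuous_fst)
  have hKI : closure A ⊆ Set.Icc (0 : ℝ) 1 ×ˢ Set.Icc (0 : ℝ) 1 := by
    refine closure_minimal (fun q hq => ?_) (isClosed_Icc.prod isClosed_Icc)
    have := hA.subset hq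
    rw [hW] at this
    exact Set.prod_mono Set.Ioo_subset_Icc_self Set.Ioo_subset_Icc_self this.1
  have hK : IsCompact (closure A) :=
    (isCompact_Icc.prod isCompact_Icc).of_isClosed_subset isClosed_closure hKI
  obtain ⟨p, hp, hmax⟩ := hK.exists_isMaxOn ⟨q₀, subset_closure hq₀⟩
    (f := fun q => φ q / cos (μ * (q.1 - m))) (by
      refine hφ.continuous.continuousOn.div (by fun_prop) fun q hq => (hcos _ (hKs q hq)).ne')
  have hcp := hcos _ (hKs p hp)
  have hφp : 0 < φ p := by
    have h1 : φ q₀ / cos (μ * (q₀.1 - m)) ≤ φ p / cos (μ * (p.1 - m)) := hmax (subset_closure hq₀)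
    have h2 := div_pos hpos (hcos _ (hKs _ (subset_closure hq₀)))
    exact (div_pos_iff_of_pos_right hcp).1 (h2.trans_le h1)
  have hpR : p ∈ Set.Ioo (0 : ℝ) 1 ×ˢ Set.Ioo (0 : ℝ) 1 := by
    by_contra hpR
    refine hφp.ne' (hbd p ?_)
    rw [(isClosed_Icc.prod isClosed_Icc).frontier_eq]
    refine ⟨hKI hp, ?_⟩
    rwa [interior_prod_eq, interior_Icc]
  have hpA : p ∈ A := hA.closure_inter_subset hWo ⟨hp, by rw [hW]; exact ⟨hpR, hφp.ne'⟩⟩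
  have hAn : A ∈ nhds p := (hA.isOpen hWo).mem_nhds hpA
  set w := φ p / cos (μ * (p.1 - m)) with hw
  have hwp : w * cos (μ * (p.1 - m)) = φ p := by
    rw [hw]
    field_simp
  have hle : ∀ q ∈ A, φ q ≤ w * cos (μ * (q.1 - m)) := by
    intro q hq
    have h1 : φ q / cos (μ * (q.1 - m)) ≤ w := hmax (subset_closure hq)
    rwa [div_le_iff₀ (hcos _ (hKs _ (subset_closure hq)))] at h1
  have hx : deriv (fun x => deriv (fun x' => φ (x', p.2)) x) p.1 ≤ -μ ^ 2 * φ p := by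
    have hloc : IsLocalMax (fun x => φ (x, p.2) - w * cos (μ * (x - m))) p.1 := by
      have hc : Continuous fun x : ℝ => ((x, p.2) : ℝ × ℝ) := by fun_prop
      filter_upwards [hc.continuousAt.eventually hAn] with x hx
      have := hle _ hx
      simp only at this ⊢
      rw [hwp]
      linarith
    have h2 := hloc.deriv_deriv_nonpos (by
      have := hφ.continuous
      fun_prop)
    have hd1 : Differentiable ℝ fun x => φ (x, p.2) :=
      (hφ.differentiable two_ne_zero).comp (by fun_prop)
    have hc2 : ContDiff ℝ 2 fun x => φ (x, p.2) := hφ.comp (by fun_prop)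
    have hd2 : Differentiable ℝ (deriv fun x => φ (x, p.2)) :=
      ((contDiff_succ_iff_deriv (n := 1)).1 hc2).2.2.differentiable one_ne_zero
    have e1 : ∀ x, HasDerivAt (fun x => w * cos (μ * (x - m))) (-(w * μ * sin (μ * (x - m)))) x := by
      intro x
      have h1 : HasDerivAt (fun x => μ * (x - m)) μ x := by
        simpa using ((hasDerivAt_id x).sub_const m).const_mul μ
      convert! (h1.cos.const_mul w) using 1
      ring
    have e2 : HasDerivAt (fun x => -(w * μ * sin (μ * (x - m))))
        (-(w * μ ^ 2 * cos (μ * (p.1 - m)))) p.1 := by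
      have h1 : HasDerivAt (fun x => μ * (x - m)) μ p.1 := by
        simpa using ((hasDerivAt_id p.1).sub_const m).const_mul μ
      convert! (h1.sin.const_mul (w * μ)).neg using 1
      ring
    have e3 : deriv (fun x => φ (x, p.2) - w * cos (μ * (x - m))) =
        fun x => deriv (fun x' => φ (x', p.2)) x - -(w * μ * sin (μ * (x - m))) := by
      funext x
      exact ((hd1 x).hasDerivAt.sub (e1 x)).deriv
    rw [e3, ((hd2 p.1).hasDerivAt.fun_sub e2).deriv] at h2
    have h3 : deriv (fun x => deriv (fun x' => φ (x', p.2)) x) p.1 + μ ^ 2 * φ p ≤ 0 := by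
      rw [← hwp]
      refine le_trans (le_of_eq ?_) h2
      ring
    linarith
  have hy : deriv (fun y => deriv (fun y' => φ (p.1, y')) y) p.2 ≤ 0 := by
    refine IsLocalMax.deriv_deriv_nonpos (f := fun y => φ (p.1, y)) ?_ (by
      have := hφ.continuous
      fun_prop)
    have hc : Continuous fun y : ℝ => ((p.1, y) : ℝ × ℝ) := by fun_prop
    filter_upwards [hc.continuousAt.eventually hAn] with y hy
    have := hle _ hy
    rwa [hwp] at this
  have hl := hlap p (hKI hp)
  rw [laplacian2] at hl
  nlinarith

/-- A nodal domain with eigenvalue `λ` is not contained in a vertical strip of width less than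
`π / √λ`. -/
theorem pi_le_of_subset_strip {φ : ℝ × ℝ → ℝ} {lam : ℝ} {W A : Set (ℝ × ℝ)}
    (hφ : ContDiff ℝ 2 φ)
    (hlap : ∀ p ∈ Set.Icc (0 : ℝ) 1 ×ˢ Set.Icc (0 : ℝ) 1, laplacian2 φ p = -lam * φ p)
    (hbd : ∀ p ∈ frontier (Set.Icc (0 : ℝ) 1 ×ˢ Set.Icc (0 : ℝ) 1), φ p = 0)
    (hW : W = {q | q ∈ Set.Ioo (0 : ℝ) 1 ×ˢ Set.Ioo (0 : ℝ) 1 ∧ φ q ≠ 0})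
    (hA : IsComponentOf W A) {α β : ℝ} (hstrip : ∀ q ∈ A, q.1 ∈ Set.Ioo α β) :
    π ≤ (β - α) * √lam := by
  obtain ⟨q, hq⟩ := hA.nonempty
  have hq0 : φ q ≠ 0 := by
    have := hA.subset hq
    rw [hW] at this
    exact this.2
  rcases lt_or_gt_of_ne hq0 with h | h
  · refine pi_le_of_subset_strip_of_pos (φ := -φ) hφ.neg (fun p hp => ?_) (fun p hp => ?_)
      (by simpa using hW) hA hstrip ⟨q, hq, by simpa using h⟩
    · have := hlap p hp
      simp only [laplacian2, Pi.neg_apply, deriv.fun_neg] at this ⊢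
      linarith
    · simpa using hbd p hp
  · exact pi_le_of_subset_strip_of_pos hφ hlap hbd hW hA hstrip ⟨q, hq, h⟩

theorem integral_mul_sin_mul_cos_pow_eq_zero {h : ℝ → ℝ} (hc : Continuous h)
    (hh : ∀ k : ℕ, ∫ y in (0 : ℝ)..1, h y * sin (k * (π * y)) = 0) (m k : ℕ) :
    ∫ y in (0 : ℝ)..1, h y * sin (k * (π * y)) * cos (π * y) ^ m = 0 := by
  induction m generalizing k with
  | zero => simpa using hh k
  | succ m ih =>
    rcases k with _ | k
    · simp
    · have h1 := ih k
      have h2 := ih (k + 2)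
      have : ∀ y, h y * sin ((k + 1 : ℕ) * (π * y)) * cos (π * y) ^ (m + 1) =
          2⁻¹ * (h y * sin (k * (π * y)) * cos (π * y) ^ m +
            h y * sin ((k + 2 : ℕ) * (π * y)) * cos (π * y) ^ m) := by
        intro y
        have h3 := Real.two_mul_sin_mul_cos ((k + 1 : ℕ) * (π * y)) (π * y)
        have e1 : ((k + 1 : ℕ) : ℝ) * (π * y) - π * y = k * (π * y) := by push_cast; ring
        have e2 : ((k + 1 : ℕ) : ℝ) * (π * y) + π * y = (k + 2 : ℕ) * (π * y) := by
          push_cast; ring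
        rw [e1, e2] at h3
        rw [pow_succ]
        linear_combination h y * cos (π * y) ^ m / 2 * h3
      simp_rw [this]
      rw [intervalIntegral.integral_const_mul, intervalIntegral.integral_add
        ((by fun_prop : Continuous _).intervalIntegrable _ _)
        ((by fun_prop : Continuous _).intervalIntegrable _ _), h1, h2]
      simp

/-- Completeness of the sine system: a continuous function on `[0, 1]` all of whose sine
coefficients vanish is zero. -/
theorem eq_zero_of_forall_integral_mul_sin_eq_zero {h : ℝ → ℝ} (hc : Continuous h)
    (hh : ∀ k : ℕ, ∫ y in (0 : ℝ)..1, h y * sin (k * (π * y)) = 0) {y : ℝ}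
    (hy : y ∈ Set.Icc (0 : ℝ) 1) : h y = 0 := by
  set g : ℝ → ℝ := fun y => h y * sin (π * y) with hg
  have hgc : Continuous g := by fun_prop
  have hpoly : ∀ p : Polynomial ℝ, ∫ y in (0 : ℝ)..1, g y * p.eval (cos (π * y)) = 0 := by
    intro p
    induction p using Polynomial.induction_on' with
    | add p q hp hq =>
      simp only [Polynomial.eval_add, mul_add]
      rw [intervalIntegral.integral_add
        ((by fun_prop : Continuous _).intervalIntegrable _ _)
        ((by fun_prop : Continuous _).intervalIntegrable _ _), hp, hq, add_zero]
    | monomial m a =>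
      simp only [Polynomial.eval_monomial]
      have := integral_mul_sin_mul_cos_pow_eq_zero hc hh m 1
      have e : ∀ y, g y * (a * cos (π * y) ^ m) =
          a * (h y * sin ((1 : ℕ) * (π * y)) * cos (π * y) ^ m) := by
        intro y
        simp only [hg, Nat.cast_one, one_mul]
        ring
      simp_rw [e]
      rw [intervalIntegral.integral_const_mul, this, mul_zero]
  obtain ⟨B, hB⟩ := (isCompact_Icc (a := (0 : ℝ)) (b := 1)).exists_bound_of_continuousOn
    hgc.continuousOn
  have hB0 : 0 ≤ B := (norm_nonneg _).trans (hB 0 (by simp))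
  have hsq : ∫ y in (0 : ℝ)..1, g y ^ 2 = 0 := by
    have h0 : 0 ≤ ∫ y in (0 : ℝ)..1, g y ^ 2 :=
      intervalIntegral.integral_nonneg zero_le_one fun y _ => sq_nonneg _
    refine le_antisymm (le_of_forall_pos_le_add fun ε hε => ?_) h0
    obtain ⟨p, hp⟩ := exists_polynomial_near_of_continuousOn (-1) 1 (fun t => g (arccos t / π))
      (by have := Real.continuous_arccos; fun_prop) (ε / (B + 1)) (by positivity)
    have key : ∫ y in (0 : ℝ)..1, g y ^ 2 =
        ∫ y in (0 : ℝ)..1, g y * (g y - p.eval (cos (π * y))) := by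
      simp only [mul_sub]
      rw [intervalIntegral.integral_sub
        ((by fun_prop : Continuous _).intervalIntegrable _ _)
        ((by fun_prop : Continuous _).intervalIntegrable _ _), hpoly p, sub_zero]
      simp only [sq]
    rw [key, zero_add]
    have := intervalIntegral.norm_integral_le_of_norm_le_const (a := (0 : ℝ)) (b := 1) (C := ε)
      (f := fun y => g y * (g y - p.eval (cos (π * y)))) (by
        intro y hy
        rw [Set.uIoc_of_le zero_le_one] at hy
        have h1 := hB y (Set.Ioc_subset_Icc_self hy)
        have h2 := hp (cos (π * y)) ⟨neg_one_le_cos _, cos_le_one _⟩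
        rw [arccos_cos (by nlinarith [pi_pos, hy.1]) (by nlinarith [pi_pos, hy.2]),
          mul_div_cancel_left₀ _ pi_ne_zero, abs_sub_comm] at h2
        rw [norm_mul]
        calc ‖g y‖ * ‖g y - p.eval (cos (π * y))‖ ≤ B * (ε / (B + 1)) := by
              gcongr
              exact h2.le
          _ ≤ ε := by
              rw [mul_div_assoc', div_le_iff₀ (by positivity)]
              nlinarith)
    simp only [sub_zero, abs_one, mul_one] at this
    exact (le_abs_self _).trans this
  have hg0 : ∀ y ∈ Set.Icc (0 : ℝ) 1, g y = 0 := by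
    intro y hy
    by_contra hne
    refine hsq.not_gt (intervalIntegral.integral_pos zero_lt_one (by fun_prop)
      (fun y _ => sq_nonneg _) ⟨y, hy, by positivity⟩)
  have hIoo : ∀ y ∈ Set.Ioo (0 : ℝ) 1, h y = 0 := by
    intro y hy
    have hs : sin (π * y) ≠ 0 :=
      (sin_pos_of_pos_of_lt_pi (by nlinarith [pi_pos, hy.1]) (by nlinarith [pi_pos, hy.2])).ne'
    exact (mul_eq_zero.1 (hg0 y (Set.Ioo_subset_Icc_self hy))).resolve_right hs
  have hcl : Set.Icc (0 : ℝ) 1 ⊆ {y | h y = 0} := by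
    rw [← closure_Ioo zero_ne_one]
    exact closure_minimal hIoo (isClosed_eq hc continuous_const)
  exact hcl hy

theorem integral_sin_nat_mul_sin_nat (j k : ℕ) :
    ∫ y in (0 : ℝ)..1, sin ((j + 1 : ℕ) * (π * y)) * sin (k * (π * y)) =
      if j + 1 = k then 1 / 2 else 0 := by
  have hcosint : ∀ n : ℤ, ∫ y in (0 : ℝ)..1, cos (n * (π * y)) = if n = 0 then 1 else 0 := by
    intro n
    split_ifs with hn
    · simp [hn]
    · have hne : (n : ℝ) * π ≠ 0 := mul_ne_zero (by exact_mod_cast hn) pi_ne_zero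
      simp_rw [← mul_assoc]
      rw [intervalIntegral.integral_comp_mul_left (fun x => cos x) hne]
      simp [sin_int_mul_pi]
  have e : ∀ y, sin ((j + 1 : ℕ) * (π * y)) * sin (k * (π * y)) =
      2⁻¹ * (cos (((j + 1 - k : ℤ) : ℝ) * (π * y)) - cos (((j + 1 + k : ℤ) : ℝ) * (π * y))) := by
    intro y
    have := Real.two_mul_sin_mul_sin ((j + 1 : ℕ) * (π * y)) (k * (π * y))
    rw [← sub_mul, ← add_mul] at this
    push_cast at this ⊢
    linarith
  simp_rw [e]
  rw [intervalIntegral.integral_const_mul, intervalIntegral.integral_sub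
        ((by fun_prop : Continuous _).intervalIntegrable _ _)
        ((by fun_prop : Continuous _).intervalIntegrable _ _), hcosint, hcosint,
        if_neg (show (j + 1 + k : ℤ) ≠ 0 by omega)]
  by_cases hjk : j + 1 = k
  · rw [if_pos hjk, if_pos (by omega)]
    norm_num
  · rw [if_neg hjk, if_neg (by omega)]
    norm_num

/-- If the sine coefficients of `h` of index greater than `K` vanish, then `h` either vanishes on
`[0, 1]` or has at most `K` zeros in `(0, 1)`. -/
theorem eq_zero_or_ncard_zeros_le {h : ℝ → ℝ} (hc : Continuous h) (K : ℕ)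
    (hh : ∀ k : ℕ, K < k → ∫ y in (0 : ℝ)..1, h y * sin (k * (π * y)) = 0) :
    (∀ y ∈ Set.Icc (0 : ℝ) 1, h y = 0) ∨
      ({y ∈ Set.Ioo (0 : ℝ) 1 | h y = 0}.Finite ∧
        {y ∈ Set.Ioo (0 : ℝ) 1 | h y = 0}.ncard ≤ K) := by
  set b : ℕ → ℝ := fun k => 2 * ∫ y in (0 : ℝ)..1, h y * sin (k * (π * y)) with hb
  have hexp : ∀ y ∈ Set.Icc (0 : ℝ) 1,
      h y = ∑ j ∈ Finset.range K, b (j + 1) * sin ((j + 1 : ℕ) * (π * y)) := by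
    intro y hy
    rw [← sub_eq_zero]
    refine eq_zero_of_forall_integral_mul_sin_eq_zero
      (h := fun y => h y - ∑ j ∈ Finset.range K, b (j + 1) * sin ((j + 1 : ℕ) * (π * y)))
      (by fun_prop) (fun k => ?_) hy
    simp only [sub_mul, Finset.sum_mul, mul_assoc (b _)]
    rw [intervalIntegral.integral_sub ((by fun_prop : Continuous _).intervalIntegrable _ _)
      ((by fun_prop : Continuous _).intervalIntegrable _ _),
      intervalIntegral.integral_finsetSum
        fun j _ => (by fun_prop : Continuous _).intervalIntegrable _ _]
    simp only [intervalIntegral.integral_const_mul, integral_sin_nat_mul_sin_nat]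
    rcases k with _ | k
    · simp
    · simp only [add_left_inj, mul_ite, mul_zero, Finset.sum_ite_eq', Finset.mem_range]
      split_ifs with hk
      · simp only [hb]
        ring
      · rw [hh (k + 1) (by omega), sub_zero]
  set P : Polynomial ℝ :=
    ∑ j ∈ Finset.range K, Polynomial.C (b (j + 1)) * Polynomial.Chebyshev.U ℝ j with hP
  have hfac : ∀ y ∈ Set.Icc (0 : ℝ) 1, h y = P.eval (cos (π * y)) * sin (π * y) := by
    intro y hy
    rw [hexp y hy, hP, Polynomial.eval_finsetSum, Finset.sum_mul]
    refine Finset.sum_congr rfl fun j _ => ?_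
    have := Polynomial.Chebyshev.U_real_cos (π * y) j
    rw [Polynomial.eval_mul, Polynomial.eval_C]
    push_cast at this ⊢
    linear_combination -b (j + 1) * this
  have hdeg : P.natDegree ≤ K := by
    refine Polynomial.natDegree_sum_le_of_forall_le _ _ fun j hj => ?_
    refine (Polynomial.natDegree_C_mul_le _ _).trans ?_
    rw [Polynomial.Chebyshev.natDegree_U_natCast]
    exact (Finset.mem_range.1 hj).le
  by_cases hP0 : P = 0
  · left
    intro y hy
    simp [hfac y hy, hP0]
  · right
    have hmaps : Set.MapsTo (fun y => cos (π * y)) {y ∈ Set.Ioo (0 : ℝ) 1 | h y = 0}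
        (P.roots.toFinset : Set ℝ) := by
      rintro y ⟨hy, hy0⟩
      have hs : sin (π * y) ≠ 0 :=
        (sin_pos_of_pos_of_lt_pi (by nlinarith [pi_pos, hy.1]) (by nlinarith [pi_pos, hy.2])).ne'
      rw [hfac y (Set.Ioo_subset_Icc_self hy)] at hy0
      simpa [hP0] using (mul_eq_zero.1 hy0).resolve_right hs
    have hinj : Set.InjOn (fun y => cos (π * y)) {y ∈ Set.Ioo (0 : ℝ) 1 | h y = 0} := by
      rintro y ⟨hy, -⟩ z ⟨hz, -⟩ hyz
      have := injOn_cos ⟨by nlinarith [pi_pos, hy.1], by nlinarith [pi_pos, hy.2]⟩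
        ⟨by nlinarith [pi_pos, hz.1], by nlinarith [pi_pos, hz.2]⟩ hyz
      exact mul_left_cancel₀ pi_ne_zero this
    refine ⟨Set.Finite.of_injOn hmaps hinj (Finset.finite_toSet _), ?_⟩
    calc _ ≤ (P.roots.toFinset : Set ℝ).ncard :=
          Set.ncard_le_ncard_of_injOn _ hmaps hinj (Finset.finite_toSet _)
      _ ≤ P.roots.card := by
          rw [Set.ncard_coe_finset]
          exact Multiset.toFinset_card_le _
      _ ≤ K := (P.card_roots').trans hdeg

theorem integral_deriv_deriv_mul_sin {u u' u'' : ℝ → ℝ} (h1 : ∀ x, HasDerivAt u (u' x) x)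
    (h2 : ∀ x, HasDerivAt u' (u'' x) x) (hc : Continuous u'') (h0 : u 0 = 0) (h1' : u 1 = 0)
    (k : ℕ) :
    ∫ x in (0 : ℝ)..1, u'' x * sin (k * (π * x)) =
      -(k * π) ^ 2 * ∫ x in (0 : ℝ)..1, u x * sin (k * (π * x)) := by
  have hcu' : Continuous u' := continuous_iff_continuousAt.2 fun x => (h2 x).continuousAt
  have hcu : Continuous u := continuous_iff_continuousAt.2 fun x => (h1 x).continuousAt
  have hin : ∀ x : ℝ, HasDerivAt (fun x : ℝ => k * (π * x)) (k * π) x := fun x => by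
    simpa using ((hasDerivAt_id x).const_mul π).const_mul (k : ℝ)
  have key : ∀ x, HasDerivAt
      (fun x => u' x * sin (k * (π * x)) - k * π * (u x * cos (k * (π * x))))
      (u'' x * sin (k * (π * x)) + (k * π) ^ 2 * (u x * sin (k * (π * x)))) x := by
    intro x
    convert! ((h2 x).mul (hin x).sin).sub (((h1 x).mul (hin x).cos).const_mul (k * π)) using 1
    ring
  have := intervalIntegral.integral_eq_sub_of_hasDerivAt (a := 0) (b := 1) (fun x _ => key x)
    ((by fun_prop : Continuous _).intervalIntegrable _ _)
  rw [intervalIntegral.integral_add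
        ((by fun_prop : Continuous _).intervalIntegrable _ _)
        ((by fun_prop : Continuous _).intervalIntegrable _ _),
      intervalIntegral.integral_const_mul] at this
  simp only [h0, h1', mul_one, mul_zero, sin_zero, sin_nat_mul_pi, zero_mul, sub_zero] at this
  linarith

theorem Continuous.integral_integral_swap_unitInterval {F : ℝ → ℝ → ℝ}
    (hF : Continuous F.uncurry) :
    ∫ x in (0 : ℝ)..1, ∫ y in (0 : ℝ)..1, F x y = ∫ y in (0 : ℝ)..1, ∫ x in (0 : ℝ)..1, F x y := by
  refine MeasureTheory.intervalIntegral_intervalIntegral_swap ?_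
  exact (hF.continuousOn.integrableOn_compact (isCompact_uIcc.prod isCompact_uIcc)).mono_set
    (Set.prod_mono Set.uIoc_subset_uIcc Set.uIoc_subset_uIcc)

/-- The slices of a `C²` function in the first variable are twice differentiable, with jointly
continuous second derivative. -/
theorem ContDiff.exists_deriv_deriv_fst {φ : ℝ × ℝ → ℝ} (hφ : ContDiff ℝ 2 φ) :
    ∃ φ₁ φ₂ : ℝ × ℝ → ℝ, Continuous φ₂ ∧
      (∀ x y, HasDerivAt (fun x' => φ (x', y)) (φ₁ (x, y)) x) ∧
      (∀ x y, HasDerivAt (fun x' => φ₁ (x', y)) (φ₂ (x, y)) x) := by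
  have hstep : ∀ ψ : ℝ × ℝ → ℝ, Differentiable ℝ ψ → ∀ x y : ℝ,
      HasDerivAt (fun x' => ψ (x', y)) (fderiv ℝ ψ (x, y) (1, 0)) x := by
    intro ψ hψ x y
    have h1 : HasDerivAt (fun x' : ℝ => (x', y)) ((1 : ℝ), (0 : ℝ)) x :=
      (hasDerivAt_id x).prodMk (hasDerivAt_const x y)
    exact (hψ (x, y)).hasFDerivAt.comp_hasDerivAt x h1
  have hφ₁ : ContDiff ℝ 1 fun q => fderiv ℝ φ q (1, 0) :=
    (hφ.fderiv_right (m := 1) (by norm_num)).clm_apply contDiff_const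
  refine ⟨fun q => fderiv ℝ φ q (1, 0), fun q => fderiv ℝ (fun q => fderiv ℝ φ q (1, 0)) q (1, 0),
    ?_, fun x y => hstep φ (hφ.differentiable two_ne_zero) x y,
    fun x y => hstep _ (hφ₁.differentiable one_ne_zero) x y⟩
  exact (hφ₁.continuous_fderiv one_ne_zero).clm_apply continuous_const

theorem laplacian2_swap (φ : ℝ × ℝ → ℝ) (p : ℝ × ℝ) :
    laplacian2 (fun q => φ q.swap) p = laplacian2 φ p.swap := by
  simp only [laplacian2, Prod.swap_prod_mk, Prod.fst_swap, Prod.snd_swap]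
  rw [add_comm]

theorem eq_zero_of_mem_boundary {φ : ℝ × ℝ → ℝ}
    (hbd : ∀ p ∈ frontier (Set.Icc (0 : ℝ) 1 ×ˢ Set.Icc (0 : ℝ) 1), φ p = 0) {p : ℝ × ℝ}
    (hp : p ∈ Set.Icc (0 : ℝ) 1 ×ˢ Set.Icc (0 : ℝ) 1)
    (hp' : p ∉ Set.Ioo (0 : ℝ) 1 ×ˢ Set.Ioo (0 : ℝ) 1) : φ p = 0 := by
  refine hbd p ?_
  rw [(isClosed_Icc.prod isClosed_Icc).frontier_eq]
  exact ⟨hp, by rwa [interior_prod_eq, interior_Icc]⟩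

/-- A double sine coefficient of an eigenfunction vanishes away from the eigenvalue. -/
theorem integral_integral_mul_sin_mul_sin_eq_zero {φ : ℝ × ℝ → ℝ} {lam : ℝ}
    (hφ : ContDiff ℝ 2 φ)
    (hlap : ∀ p ∈ Set.Icc (0 : ℝ) 1 ×ˢ Set.Icc (0 : ℝ) 1, laplacian2 φ p = -lam * φ p)
    (hbd : ∀ p ∈ frontier (Set.Icc (0 : ℝ) 1 ×ˢ Set.Icc (0 : ℝ) 1), φ p = 0)
    {j k : ℕ} (hjk : (j * π) ^ 2 + (k * π) ^ 2 ≠ lam) :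
    ∫ x in (0 : ℝ)..1, ∫ y in (0 : ℝ)..1,
      φ (x, y) * sin (k * (π * y)) * sin (j * (π * x)) = 0 := by
  obtain ⟨φ₁, φ₂, hc₂, hd₁, hd₂⟩ := hφ.exists_deriv_deriv_fst
  obtain ⟨ψ₁, ψ₂, hc₂', hd₁', hd₂'⟩ :=
    (hφ.comp (contDiff_snd.prodMk contDiff_fst)).exists_deriv_deriv_fst
  simp only [Function.comp_apply] at hd₁'
  have hφc := hφ.continuous
  have hz0 : ∀ y ∈ Set.Icc (0 : ℝ) 1, φ (0, y) = 0 ∧ φ (1, y) = 0 ∧ φ (y, 0) = 0 ∧ φ (y, 1) = 0 := by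
    intro y hy
    refine ⟨?_, ?_, ?_, ?_⟩ <;> exact eq_zero_of_mem_boundary hbd (by simp [hy.1, hy.2]) (by simp)
  have heq : ∀ x ∈ Set.Icc (0 : ℝ) 1, ∀ y ∈ Set.Icc (0 : ℝ) 1,
      φ₂ (x, y) + ψ₂ (y, x) = -lam * φ (x, y) := by
    intro x hx y hy
    rw [← hlap (x, y) ⟨hx, hy⟩, laplacian2]
    have e1 : (fun x => deriv (fun x' => φ (x', y)) x) = fun x => φ₁ (x, y) :=
      funext fun x => (hd₁ x y).deriv
    have e2 : (fun y => deriv (fun y' => φ (x, y')) y) = fun y => ψ₁ (y, x) :=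
      funext fun y => (hd₁' y x).deriv
    simp only [e1, e2, (hd₂ x y).deriv, (hd₂' y x).deriv]
  set I := ∫ x in (0 : ℝ)..1, ∫ y in (0 : ℝ)..1,
      φ (x, y) * sin (k * (π * y)) * sin (j * (π * x)) with hI
  have hIx : ∫ x in (0 : ℝ)..1, ∫ y in (0 : ℝ)..1,
      φ₂ (x, y) * sin (k * (π * y)) * sin (j * (π * x)) = -(j * π) ^ 2 * I := by
    rw [hI, Continuous.integral_integral_swap_unitInterval
        (F := fun x y => φ₂ (x, y) * sin (k * (π * y)) * sin (j * (π * x))) (by fun_prop),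
      Continuous.integral_integral_swap_unitInterval
        (F := fun x y => φ (x, y) * sin (k * (π * y)) * sin (j * (π * x))) (by fun_prop),
      ← intervalIntegral.integral_const_mul]
    refine intervalIntegral.integral_congr fun y hy => ?_
    rw [Set.uIcc_of_le zero_le_one] at hy
    have := integral_deriv_deriv_mul_sin (fun x => hd₁ x y) (fun x => hd₂ x y) (by fun_prop)
      (hz0 y hy).1 (hz0 y hy).2.1 j
    simp only [mul_right_comm _ (sin (k * (π * y))), intervalIntegral.integral_mul_const]
    rw [this]
    ring
  have hIy : ∫ x in (0 : ℝ)..1, ∫ y in (0 : ℝ)..1,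
      ψ₂ (y, x) * sin (k * (π * y)) * sin (j * (π * x)) = -(k * π) ^ 2 * I := by
    rw [hI, ← intervalIntegral.integral_const_mul]
    refine intervalIntegral.integral_congr fun x hx => ?_
    rw [Set.uIcc_of_le zero_le_one] at hx
    have := integral_deriv_deriv_mul_sin (fun y => hd₁' y x) (fun y => hd₂' y x) (by fun_prop)
      (hz0 x hx).2.2.1 (hz0 x hx).2.2.2 k
    simp only [intervalIntegral.integral_mul_const]
    rw [this]
    ring
  have hsum : -lam * I = -(j * π) ^ 2 * I + -(k * π) ^ 2 * I := by
    rw [← hIx, ← hIy, hI, ← intervalIntegral.integral_const_mul,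
      ← intervalIntegral.integral_add ((by fun_prop : Continuous _).intervalIntegrable _ _)
        ((by fun_prop : Continuous _).intervalIntegrable _ _)]
    refine intervalIntegral.integral_congr fun x hx => ?_
    rw [Set.uIcc_of_le zero_le_one] at hx
    rw [← intervalIntegral.integral_const_mul,
      ← intervalIntegral.integral_add ((by fun_prop : Continuous _).intervalIntegrable _ _)
        ((by fun_prop : Continuous _).intervalIntegrable _ _)]
    refine intervalIntegral.integral_congr fun y hy => ?_
    rw [Set.uIcc_of_le zero_le_one] at hy
    linear_combination -sin (k * (π * y)) * sin (j * (π * x)) * heq x hx y hy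
  have : ((j * π) ^ 2 + (k * π) ^ 2 - lam) * I = 0 := by linarith
  exact (mul_eq_zero.1 this).resolve_left (sub_ne_zero.2 hjk)

/-- A Dirichlet eigenfunction with eigenvalue `λ` either vanishes on a given vertical line or has
at most `√λ / π` zeros on it. -/
theorem eq_zero_or_ncard_zeros_vertical_le {φ : ℝ × ℝ → ℝ} {lam : ℝ}
    (hφ : ContDiff ℝ 2 φ)
    (hlap : ∀ p ∈ Set.Icc (0 : ℝ) 1 ×ˢ Set.Icc (0 : ℝ) 1, laplacian2 φ p = -lam * φ p)
    (hbd : ∀ p ∈ frontier (Set.Icc (0 : ℝ) 1 ×ˢ Set.Icc (0 : ℝ) 1), φ p = 0)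
    {c : ℝ} (hc : c ∈ Set.Icc (0 : ℝ) 1) :
    (∀ y ∈ Set.Icc (0 : ℝ) 1, φ (c, y) = 0) ∨
      ({y ∈ Set.Ioo (0 : ℝ) 1 | φ (c, y) = 0}.Finite ∧
        ({y ∈ Set.Ioo (0 : ℝ) 1 | φ (c, y) = 0}.ncard : ℝ) ≤ √lam / π) := by
  have hφc := hφ.continuous
  have hK : ∀ k : ℕ, ⌊√lam / π⌋₊ < k →
      ∫ y in (0 : ℝ)..1, φ (c, y) * sin (k * (π * y)) = 0 := by
    intro k hk
    have hk0 : (0 : ℝ) < k := Nat.cast_pos.2 (pos_of_gt hk)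
    rw [Nat.floor_lt (by positivity), div_lt_iff₀ pi_pos, Real.sqrt_lt' (by positivity)] at hk
    refine eq_zero_of_forall_integral_mul_sin_eq_zero
      (h := fun x => ∫ y in (0 : ℝ)..1, φ (x, y) * sin (k * (π * y)))
      (by fun_prop) (fun j => ?_) hc
    simp only [← intervalIntegral.integral_mul_const]
    exact integral_integral_mul_sin_mul_sin_eq_zero hφ hlap hbd (by nlinarith)
  refine (eq_zero_or_ncard_zeros_le (by fun_prop) _ hK).imp_right fun h => ⟨h.1, ?_⟩
  exact (Nat.cast_le.2 h.2).trans (Nat.floor_le (by positivity))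

theorem eq_zero_or_ncard_zeros_horizontal_le {φ : ℝ × ℝ → ℝ} {lam : ℝ}
    (hφ : ContDiff ℝ 2 φ)
    (hlap : ∀ p ∈ Set.Icc (0 : ℝ) 1 ×ˢ Set.Icc (0 : ℝ) 1, laplacian2 φ p = -lam * φ p)
    (hbd : ∀ p ∈ frontier (Set.Icc (0 : ℝ) 1 ×ˢ Set.Icc (0 : ℝ) 1), φ p = 0)
    {c : ℝ} (hc : c ∈ Set.Icc (0 : ℝ) 1) :
    (∀ x ∈ Set.Icc (0 : ℝ) 1, φ (x, c) = 0) ∨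
      ({x ∈ Set.Ioo (0 : ℝ) 1 | φ (x, c) = 0}.Finite ∧
        ({x ∈ Set.Ioo (0 : ℝ) 1 | φ (x, c) = 0}.ncard : ℝ) ≤ √lam / π) := by
  refine eq_zero_or_ncard_zeros_vertical_le (φ := fun q => φ q.swap) (lam := lam)
    (hφ.comp (contDiff_snd.prodMk contDiff_fst)) (fun p hp => ?_) (fun p hp => hbd _ ?_) hc
  · rw [laplacian2_swap]
    exact hlap _ ⟨hp.2, hp.1⟩
  · rw [(isClosed_Icc.prod isClosed_Icc).frontier_eq, interior_prod_eq, interior_Icc] at hp ⊢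
    exact ⟨⟨hp.1.2, hp.1.1⟩, fun h => hp.2 ⟨h.2, h.1⟩⟩

theorem integral_sqrt_sq_sub_sq {s : ℝ} (hs : 0 < s) :
    ∫ x in (0 : ℝ)..s, √(s ^ 2 - x ^ 2) = π / 4 * s ^ 2 := by
  have hc : Continuous fun x : ℝ => √(1 - x ^ 2) := by fun_prop
  have h1 : ∫ x in (0 : ℝ)..1, √(1 - x ^ 2) = π / 4 := by
    have h2 := intervalIntegral.integral_comp_neg (a := 0) (b := 1) fun x : ℝ => √(1 - x ^ 2)
    have h3 := intervalIntegral.integral_add_adjacent_intervals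
      (hc.intervalIntegrable (μ := MeasureTheory.volume) (-1) 0) (hc.intervalIntegrable 0 1)
    rw [integral_sqrt_one_sub_sq] at h3
    simp only [even_two, Even.neg_pow, neg_zero] at h2
    linarith
  have h4 := intervalIntegral.integral_comp_div (a := 0) (b := s)
    (fun x : ℝ => √(1 - x ^ 2)) hs.ne'
  rw [zero_div, div_self hs.ne', h1, smul_eq_mul] at h4
  have h5 : ∀ x, √(s ^ 2 - x ^ 2) = s * √(1 - (x / s) ^ 2) := by
    intro x
    rw [← Real.sqrt_sq hs.le, ← Real.sqrt_mul (sq_nonneg s), Real.sqrt_sq hs.le]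
    congr 1
    field_simp
  simp_rw [h5]
  rw [intervalIntegral.integral_const_mul, h4]
  ring

theorem sum_floor_le_squareCounting {lam s : ℝ} (hs : 0 ≤ s) (hlam : lam = (π * s) ^ 2) :
    ∑ i ∈ Finset.Icc 1 ⌊s⌋₊, ⌊√(s ^ 2 - (i : ℝ) ^ 2)⌋₊ ≤ squareCounting lam := by
  have hiff : ∀ a b : ℕ, π ^ 2 * ((a : ℝ) ^ 2 + (b : ℝ) ^ 2) ≤ lam ↔
      (a : ℝ) ^ 2 + (b : ℝ) ^ 2 ≤ s ^ 2 := by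
    intro a b
    rw [hlam, mul_pow, mul_le_mul_iff_right₀ (by positivity)]
  have hfin : Finite {ab : ℕ × ℕ // 1 ≤ ab.1 ∧ 1 ≤ ab.2 ∧
      π ^ 2 * ((ab.1 : ℝ) ^ 2 + (ab.2 : ℝ) ^ 2) ≤ lam} := by
    refine Set.Finite.subset ((Set.finite_Iic ⌊s⌋₊).prod (Set.finite_Iic ⌊s⌋₊)) ?_
    rintro ⟨a, b⟩ ⟨-, -, h⟩
    rw [hiff] at h
    refine ⟨Nat.le_floor (abs_le_of_sq_le_sq' ?_ hs).2, Nat.le_floor (abs_le_of_sq_le_sq' ?_ hs).2⟩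
    · nlinarith
    · nlinarith
  have hcard : Nat.card ((Finset.Icc 1 ⌊s⌋₊).sigma
      fun i => Finset.Icc 1 ⌊√(s ^ 2 - (i : ℝ) ^ 2)⌋₊) =
      ∑ i ∈ Finset.Icc 1 ⌊s⌋₊, ⌊√(s ^ 2 - (i : ℝ) ^ 2)⌋₊ := by
    rw [Nat.card_eq_finsetCard, Finset.card_sigma]
    simp
  rw [← hcard]
  refine Nat.card_le_card_of_injective
    (fun x => ⟨(x.1.1, x.1.2), ?_⟩) ?_
  · obtain ⟨⟨a, b⟩, h⟩ := x
    simp only [Finset.mem_sigma, Finset.mem_Icc] at h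
    refine ⟨h.1.1, h.2.1, ?_⟩
    rw [hiff]
    have hb := (Nat.le_floor_iff (Real.sqrt_nonneg _)).1 h.2.2
    rw [Real.le_sqrt' (Nat.cast_pos.2 h.2.1)] at hb
    linarith
  · rintro ⟨⟨a, b⟩, h⟩ ⟨⟨a', b'⟩, h'⟩ e
    simp only [Subtype.mk.injEq, Prod.mk.injEq] at e
    obtain ⟨rfl, rfl⟩ := e
    rfl

/-- A Weyl lower bound for the Dirichlet counting function of the unit square. -/
theorem le_squareCounting {lam s : ℝ} (hs : 0 < s) (hlam : lam = (π * s) ^ 2) :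
    π / 4 * s ^ 2 ≤ squareCounting lam + 2 * s := by
  set f : ℝ → ℝ := fun x => √(s ^ 2 - x ^ 2) with hf
  have hfc : Continuous f := by fun_prop
  have hanti : AntitoneOn f (Set.Icc (0 : ℝ) (0 + (⌊s⌋₊ + 1 : ℕ))) := by
    intro x hx y hy hxy
    refine Real.sqrt_le_sqrt ?_
    have := pow_le_pow_left₀ hx.1 hxy 2
    linarith
  have hcosint := hanti.integral_le_sum
  have hle : ∫ x in (0 : ℝ)..s, f x ≤ ∫ x in (0 : ℝ)..(0 + (⌊s⌋₊ + 1 : ℕ)), f x := by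
    refine intervalIntegral.integral_mono_interval le_rfl hs.le ?_
      (Filter.Eventually.of_forall fun x => Real.sqrt_nonneg _) (hfc.intervalIntegrable _ _)
    have := Nat.lt_floor_add_one s
    push_cast
    linarith
  rw [integral_sqrt_sq_sub_sq hs] at hle
  rw [Finset.sum_range_succ'] at hcosint
  have hzero : f (0 + (0 : ℕ)) = s := by simp [hf, Real.sqrt_sq hs.le]
  have hsum : ∑ i ∈ Finset.range ⌊s⌋₊, f (0 + (i + 1 : ℕ)) ≤
      ((∑ i ∈ Finset.Icc 1 ⌊s⌋₊, ⌊√(s ^ 2 - (i : ℝ) ^ 2)⌋₊ : ℕ) : ℝ) + ⌊s⌋₊ := by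
    rw [Finset.range_eq_Ico, Finset.sum_Ico_add' (fun i : ℕ => f (0 + (i : ℕ))) 0 ⌊s⌋₊ 1,
      zero_add, Finset.Ico_add_one_right_eq_Icc]
    push_cast
    have hN : (⌊s⌋₊ : ℝ) = ∑ i ∈ Finset.Icc 1 ⌊s⌋₊, (1 : ℝ) := by simp
    rw [hN, ← Finset.sum_add_distrib]
    refine Finset.sum_le_sum fun i _ => ?_
    simp only [hf, zero_add]
    exact (Nat.lt_floor_add_one _).le
  have hc : ((∑ i ∈ Finset.Icc 1 ⌊s⌋₊, ⌊√(s ^ 2 - (i : ℝ) ^ 2)⌋₊ : ℕ) : ℝ) ≤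
      squareCounting lam := Nat.cast_le.2 (sum_floor_le_squareCounting hs.le hlam)
  have hfl := Nat.floor_le hs.le
  rw [hzero] at hcosint
  linarith

theorem finite_setOf_vertical_eq_zero {φ : ℝ × ℝ → ℝ} {lam : ℝ}
    (hφ : ContDiff ℝ 2 φ)
    (hlap : ∀ p ∈ Set.Icc (0 : ℝ) 1 ×ˢ Set.Icc (0 : ℝ) 1, laplacian2 φ p = -lam * φ p)
    (hbd : ∀ p ∈ frontier (Set.Icc (0 : ℝ) 1 ×ˢ Set.Icc (0 : ℝ) 1), φ p = 0)
    (hne : ∃ p ∈ Set.Icc (0 : ℝ) 1 ×ˢ Set.Icc (0 : ℝ) 1, φ p ≠ 0) :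
    {c ∈ Set.Ioo (0 : ℝ) 1 | ∀ y ∈ Set.Icc (0 : ℝ) 1, φ (c, y) = 0}.Finite := by
  obtain ⟨⟨x, y⟩, ⟨hx, hy⟩, h⟩ := hne
  rcases eq_zero_or_ncard_zeros_horizontal_le hφ hlap hbd hy with h0 | h0
  · exact absurd (h0 x hx) h
  · exact h0.1.subset fun c hc => ⟨hc.1, hc.2 y hy⟩

theorem finite_setOf_horizontal_eq_zero {φ : ℝ × ℝ → ℝ} {lam : ℝ}
    (hφ : ContDiff ℝ 2 φ)
    (hlap : ∀ p ∈ Set.Icc (0 : ℝ) 1 ×ˢ Set.Icc (0 : ℝ) 1, laplacian2 φ p = -lam * φ p)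
    (hbd : ∀ p ∈ frontier (Set.Icc (0 : ℝ) 1 ×ˢ Set.Icc (0 : ℝ) 1), φ p = 0)
    (hne : ∃ p ∈ Set.Icc (0 : ℝ) 1 ×ˢ Set.Icc (0 : ℝ) 1, φ p ≠ 0) :
    {c ∈ Set.Ioo (0 : ℝ) 1 | ∀ x ∈ Set.Icc (0 : ℝ) 1, φ (x, c) = 0}.Finite := by
  obtain ⟨⟨x, y⟩, ⟨hx, hy⟩, h⟩ := hne
  rcases eq_zero_or_ncard_zeros_vertical_le hφ hlap hbd hx with h0 | h0
  · exact absurd (h0 y hy) h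
  · exact h0.1.subset fun c hc => ⟨hc.1, hc.2 x hx⟩

theorem setOf_notMem_vertical_eq {φ : ℝ × ℝ → ℝ} {W : Set (ℝ × ℝ)}
    (hW : W = {q | q ∈ Set.Ioo (0 : ℝ) 1 ×ˢ Set.Ioo (0 : ℝ) 1 ∧ φ q ≠ 0}) {c : ℝ}
    (hc : c ∈ Set.Ioo (0 : ℝ) 1) :
    {t ∈ Set.Ioo (0 : ℝ) 1 | (c, t) ∉ W} = {t ∈ Set.Ioo (0 : ℝ) 1 | φ (c, t) = 0} := by
  ext t
  simp only [hW, Set.mem_ofPred_eq, Set.mem_prod, not_and, not_not]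
  exact ⟨fun h => ⟨h.1, h.2 ⟨hc, h.1⟩⟩, fun h => ⟨h.1, fun _ => h.2⟩⟩

theorem setOf_notMem_horizontal_eq {φ : ℝ × ℝ → ℝ} {W : Set (ℝ × ℝ)}
    (hW : W = {q | q ∈ Set.Ioo (0 : ℝ) 1 ×ˢ Set.Ioo (0 : ℝ) 1 ∧ φ q ≠ 0}) {c : ℝ}
    (hc : c ∈ Set.Ioo (0 : ℝ) 1) :
    {t ∈ Set.Ioo (0 : ℝ) 1 | (t, c) ∉ W} = {t ∈ Set.Ioo (0 : ℝ) 1 | φ (t, c) = 0} := by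
  ext t
  simp only [hW, Set.mem_ofPred_eq, Set.mem_prod, not_and, not_not]
  exact ⟨fun h => ⟨h.1, h.2 ⟨h.1, hc⟩⟩, fun h => ⟨h.1, fun _ => h.2⟩⟩

theorem isOpen_nodal_complement {φ : ℝ × ℝ → ℝ} {W : Set (ℝ × ℝ)} (hφ : Continuous φ)
    (hW : W = {q | q ∈ Set.Ioo (0 : ℝ) 1 ×ˢ Set.Ioo (0 : ℝ) 1 ∧ φ q ≠ 0}) : IsOpen W := by
  rw [hW]
  exact (isOpen_Ioo.prod isOpen_Ioo).inter (isOpen_ne_fun hφ continuous_const)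

/-- At most `√λ / π + 1` nodal domains meet a given vertical line. -/
theorem card_le_of_meets_vertical {φ : ℝ × ℝ → ℝ} {lam : ℝ} {W : Set (ℝ × ℝ)}
    (hφ : ContDiff ℝ 2 φ)
    (hlap : ∀ p ∈ Set.Icc (0 : ℝ) 1 ×ˢ Set.Icc (0 : ℝ) 1, laplacian2 φ p = -lam * φ p)
    (hbd : ∀ p ∈ frontier (Set.Icc (0 : ℝ) 1 ×ˢ Set.Icc (0 : ℝ) 1), φ p = 0)
    (hW : W = {q | q ∈ Set.Ioo (0 : ℝ) 1 ×ˢ Set.Ioo (0 : ℝ) 1 ∧ φ q ≠ 0}) {c : ℝ}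
    (hc : c ∈ Set.Ioo (0 : ℝ) 1) (hc0 : ¬ ∀ y ∈ Set.Icc (0 : ℝ) 1, φ (c, y) = 0)
    (F : Finset (Set (ℝ × ℝ))) (hF : ∀ A ∈ F, IsComponentOf W A)
    (hne : ∀ A ∈ F, ∃ t ∈ Set.Ioo (0 : ℝ) 1, (c, t) ∈ A) : (F.card : ℝ) ≤ √lam / π + 1 := by
  have hz := (eq_zero_or_ncard_zeros_vertical_le hφ hlap hbd
    (Set.Ioo_subset_Icc_self hc)).resolve_left hc0
  rw [← setOf_notMem_vertical_eq hW hc] at hz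
  have := IsComponentOf.card_le_ncard_add_one (isOpen_nodal_complement hφ.continuous hW)
    (by fun_prop) hz.1 F hF hne
  have h2 : (F.card : ℝ) ≤ {t ∈ Set.Ioo (0 : ℝ) 1 | (c, t) ∉ W}.ncard + 1 := by exact_mod_cast this
  linarith [hz.2]

/-- At most `√λ / π + 1` nodal domains meet a given horizontal line. -/
theorem card_le_of_meets_horizontal {φ : ℝ × ℝ → ℝ} {lam : ℝ} {W : Set (ℝ × ℝ)}
    (hφ : ContDiff ℝ 2 φ)
    (hlap : ∀ p ∈ Set.Icc (0 : ℝ) 1 ×ˢ Set.Icc (0 : ℝ) 1, laplacian2 φ p = -lam * φ p)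
    (hbd : ∀ p ∈ frontier (Set.Icc (0 : ℝ) 1 ×ˢ Set.Icc (0 : ℝ) 1), φ p = 0)
    (hW : W = {q | q ∈ Set.Ioo (0 : ℝ) 1 ×ˢ Set.Ioo (0 : ℝ) 1 ∧ φ q ≠ 0}) {c : ℝ}
    (hc : c ∈ Set.Ioo (0 : ℝ) 1) (hc0 : ¬ ∀ x ∈ Set.Icc (0 : ℝ) 1, φ (x, c) = 0)
    (F : Finset (Set (ℝ × ℝ))) (hF : ∀ A ∈ F, IsComponentOf W A)
    (hne : ∀ A ∈ F, ∃ t ∈ Set.Ioo (0 : ℝ) 1, (t, c) ∈ A) : (F.card : ℝ) ≤ √lam / π + 1 := by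
  have hz := (eq_zero_or_ncard_zeros_horizontal_le hφ hlap hbd
    (Set.Ioo_subset_Icc_self hc)).resolve_left hc0
  rw [← setOf_notMem_horizontal_eq hW hc] at hz
  have := IsComponentOf.card_le_ncard_add_one (isOpen_nodal_complement hφ.continuous hW)
    (by fun_prop) hz.1 F hF hne
  have h2 : (F.card : ℝ) ≤ {t ∈ Set.Ioo (0 : ℝ) 1 | (t, c) ∉ W}.ncard + 1 := by exact_mod_cast this
  linarith [hz.2]

/-- For an eigenfunction without interior singular points, at most `√λ / (2π)` nodal domains with
closure in the open square meet a given vertical line. -/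
theorem two_mul_card_le_of_meets_vertical {φ : ℝ × ℝ → ℝ} {lam : ℝ} {W : Set (ℝ × ℝ)}
    (hφ : ContDiff ℝ 2 φ)
    (hlap : ∀ p ∈ Set.Icc (0 : ℝ) 1 ×ˢ Set.Icc (0 : ℝ) 1, laplacian2 φ p = -lam * φ p)
    (hbd : ∀ p ∈ frontier (Set.Icc (0 : ℝ) 1 ×ˢ Set.Icc (0 : ℝ) 1), φ p = 0)
    (hns : ∀ p ∈ Set.Ioo (0 : ℝ) 1 ×ˢ Set.Ioo (0 : ℝ) 1, φ p = 0 → fderiv ℝ φ p ≠ 0)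
    (hW : W = {q | q ∈ Set.Ioo (0 : ℝ) 1 ×ˢ Set.Ioo (0 : ℝ) 1 ∧ φ q ≠ 0}) {c : ℝ}
    (hc : c ∈ Set.Ioo (0 : ℝ) 1) (hc0 : ¬ ∀ y ∈ Set.Icc (0 : ℝ) 1, φ (c, y) = 0)
    (F : Finset (Set (ℝ × ℝ))) (hF : ∀ A ∈ F, IsComponentOf W A)
    (hcl : ∀ A ∈ F, closure A ⊆ Set.Ioo (0 : ℝ) 1 ×ˢ Set.Ioo (0 : ℝ) 1)
    (hne : ∀ A ∈ F, ∃ t ∈ Set.Ioo (0 : ℝ) 1, (c, t) ∈ A) : 2 * (F.card : ℝ) ≤ √lam / π := by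
  have hz := (eq_zero_or_ncard_zeros_vertical_le hφ hlap hbd
    (Set.Ioo_subset_Icc_self hc)).resolve_left hc0
  have hz' := hz
  rw [← setOf_notMem_vertical_eq hW hc] at hz
  have := IsComponentOf.two_mul_card_le_ncard (isOpen_nodal_complement hφ.continuous hW)
    (l := fun t => (c, t)) (by fun_prop) hz.1 F hF hne
    (fun A hA h => (hcl A hA h).2.1.false) (fun A hA h => (hcl A hA h).2.2.false)
    (fun A hA B hB hAB t ht htA htB h1 h2 h3 h4 => false_of_separated (hφ.of_le one_le_two) hW hns
      (hF A hA) (hF B hB) hAB (hcl A hA) ht hz'.1 htA htB h1 h2 h3 h4)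
  have h2 : 2 * (F.card : ℝ) ≤ {t ∈ Set.Ioo (0 : ℝ) 1 | (c, t) ∉ W}.ncard := by exact_mod_cast this
  linarith [hz.2]

theorem IsPreconnected.forall_mem_Ioo {S : Set ℝ} (hS : IsPreconnected S) {α β x : ℝ}
    (hα : α ∉ S) (hβ : β ∉ S) (hx : x ∈ S) (hxI : x ∈ Set.Ioo α β) : ∀ z ∈ S, z ∈ Set.Ioo α β := by
  intro z hz
  constructor
  · by_contra! h
    exact hα (hS.ordConnected.out hz hx ⟨h, hxI.1.le⟩)
  · by_contra! h
    exact hβ (hS.ordConnected.out hx hz ⟨hxI.2.le, h⟩)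

open Classical in
/-- For an eigenfunction without interior singular points, the number of nodal domains with closure
in the open square is at most `(√λ / π + 1) * √λ / (2π)`. -/
theorem card_le_of_closure_subset {φ : ℝ × ℝ → ℝ} {lam s : ℝ} {W : Set (ℝ × ℝ)}
    (hs : s = √lam / π)
    (hφ : ContDiff ℝ 2 φ)
    (hlap : ∀ p ∈ Set.Icc (0 : ℝ) 1 ×ˢ Set.Icc (0 : ℝ) 1, laplacian2 φ p = -lam * φ p)
    (hbd : ∀ p ∈ frontier (Set.Icc (0 : ℝ) 1 ×ˢ Set.Icc (0 : ℝ) 1), φ p = 0)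
    (hne : ∃ p ∈ Set.Icc (0 : ℝ) 1 ×ˢ Set.Icc (0 : ℝ) 1, φ p ≠ 0)
    (hns : ∀ p ∈ Set.Ioo (0 : ℝ) 1 ×ˢ Set.Ioo (0 : ℝ) 1, φ p = 0 → fderiv ℝ φ p ≠ 0)
    (hW : W = {q | q ∈ Set.Ioo (0 : ℝ) 1 ×ˢ Set.Ioo (0 : ℝ) 1 ∧ φ q ≠ 0})
    (F : Finset (Set (ℝ × ℝ))) (hF : ∀ A ∈ F, IsComponentOf W A)
    (hcl : ∀ A ∈ F, closure A ⊆ Set.Ioo (0 : ℝ) 1 ×ˢ Set.Ioo (0 : ℝ) 1) :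
    (F.card : ℝ) ≤ (s + 1) * (s / 2) := by
  have hs0 : 0 ≤ s := by rw [hs]; positivity
  set M : ℕ := ⌊s⌋₊ + 1 with hM
  have hM0 : (0 : ℝ) < M := by positivity
  have hsM : s < M := by rw [hM]; exact_mod_cast Nat.lt_floor_add_one s
  have hMs : (M : ℝ) ≤ s + 1 := by
    rw [hM]
    push_cast
    linarith [Nat.floor_le hs0]
  have hbad := finite_setOf_vertical_eq_zero hφ hlap hbd hne
  set V := {c ∈ Set.Ioo (0 : ℝ) 1 | ∀ y ∈ Set.Icc (0 : ℝ) 1, φ (c, y) = 0}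
  obtain ⟨θ, hθ, hθV⟩ : ∃ θ ∈ Set.Ioo (0 : ℝ) (1 / M), θ ∉ ⋃ j ∈ Finset.range M,
      (fun θ : ℝ => θ + (j : ℝ) / M) ⁻¹' V := by
    refine (Set.Ioo_infinite (by positivity)).exists_notMem_finite ?_
    exact (Finset.range M).finite_toSet.biUnion fun j _ =>
      hbad.preimage (add_left_injective _).injOn
  simp only [Set.mem_iUnion, Set.mem_preimage, not_exists] at hθV
  have hcI : ∀ j < M, θ + (j : ℝ) / M ∈ Set.Ioo (0 : ℝ) 1 := by
    intro j hj
    have hj1 : (j : ℝ) + 1 ≤ M := by exact_mod_cast hj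
    have h2 : (j : ℝ) / M + 1 / M ≤ 1 := by
      rw [← add_div, div_le_one hM0]
      exact hj1
    have h3 : 0 ≤ (j : ℝ) / M := by positivity
    constructor <;> linarith [hθ.1, hθ.2]
  have hcover : F ⊆ (Finset.range M).biUnion fun j =>
      F.filter fun A => ∃ t ∈ Set.Ioo (0 : ℝ) 1, (θ + (j : ℝ) / M, t) ∈ A := by
    intro A hA
    by_contra hno
    simp only [Finset.mem_biUnion, Finset.mem_range, Finset.mem_filter, not_exists, not_and] at hno
    have hAR : ∀ q ∈ A, q ∈ Set.Ioo (0 : ℝ) 1 ×ˢ Set.Ioo (0 : ℝ) 1 :=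
      fun q hq => hcl A hA (subset_closure hq)
    have hline : ∀ m : ℤ, θ + (m : ℝ) / M ∉ Prod.fst '' A := by
      rintro m ⟨q, hq, hqm⟩
      have hq1 := (hAR q hq).1
      rw [hqm] at hq1
      have hm1 : (-1 : ℝ) < m := by
        have : -1 / (M : ℝ) < m / M := by
          rw [neg_div]
          linarith [hq1.1, hθ.2]
        exact (div_lt_div_iff_of_pos_right hM0).1 this
      have hm2 : (m : ℝ) < M := by
        have : (m : ℝ) / M < 1 := by linarith [hq1.2, hθ.1]
        rwa [div_lt_one hM0] at this
      obtain ⟨j, rfl⟩ := Int.eq_ofNat_of_zero_le (a := m) (by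
        have : (-1 : ℤ) < m := by exact_mod_cast hm1
        omega)
      rw [Int.cast_natCast] at hm2 hqm
      refine hno j (by exact_mod_cast hm2) hA q.2 (hAR q hq).2 ?_
      rw [← hqm]
      exact hq
    obtain ⟨q, hq⟩ := (hF A hA).nonempty
    set k := ⌊(q.1 - θ) * M⌋ with hk
    have hk1 : (k : ℝ) ≤ (q.1 - θ) * M := Int.floor_le _
    have hk2 : (q.1 - θ) * M < k + 1 := Int.lt_floor_add_one _
    rw [← div_le_iff₀ hM0] at hk1
    rw [← lt_div_iff₀ hM0] at hk2
    have hmem : q.1 ∈ Prod.fst '' A := ⟨q, hq, rfl⟩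
    have h1 := hline k
    have h2 := hline (k + 1)
    push_cast at h2
    have hlt : θ + (k : ℝ) / M < q.1 := by
      refine lt_of_le_of_ne (by linarith) fun h => h1 ?_
      rw [h]
      exact hmem
    have hstrip := ((hF A hA).isPreconnected.image Prod.fst continuous_fst.continuousOn).forall_mem_Ioo
      h1 h2 hmem ⟨hlt, by linarith⟩
    have := pi_le_of_subset_strip hφ hlap hbd hW (hF A hA)
      fun z hz => hstrip z.1 ⟨z, hz, rfl⟩
    have hsq : √lam = s * π := by
      rw [hs]
      field_simp
    have hw : θ + (k + 1 : ℝ) / M - (θ + k / M) = 1 / M := by ring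
    rw [hw, hsq, one_div_mul_eq_div, le_div_iff₀ hM0, mul_comm π] at this
    exact hsM.not_ge (le_of_mul_le_mul_right this pi_pos)
  have hj : ∀ j ∈ Finset.range M, ((F.filter fun A => ∃ t ∈ Set.Ioo (0 : ℝ) 1,
      (θ + (j : ℝ) / M, t) ∈ A).card : ℝ) ≤ s / 2 := by
    intro j hjM
    have hc := hcI j (Finset.mem_range.1 hjM)
    have := two_mul_card_le_of_meets_vertical hφ hlap hbd hns hW hc
      (fun h => hθV j hjM ⟨hc, h⟩)
      (F.filter fun A => ∃ t ∈ Set.Ioo (0 : ℝ) 1, (θ + (j : ℝ) / M, t) ∈ A)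
      (fun A hA => hF A (Finset.mem_filter.1 hA).1)
      (fun A hA => hcl A (Finset.mem_filter.1 hA).1)
      (fun A hA => (Finset.mem_filter.1 hA).2)
    linarith
  calc (F.card : ℝ) ≤ ∑ j ∈ Finset.range M, ((F.filter fun A => ∃ t ∈ Set.Ioo (0 : ℝ) 1,
      (θ + (j : ℝ) / M, t) ∈ A).card : ℝ) := by
        exact_mod_cast (Finset.card_le_card hcover).trans Finset.card_biUnion_le
    _ ≤ M * (s / 2) := by
        refine (Finset.sum_le_sum hj).trans_eq ?_
        simp
    _ ≤ (s + 1) * (s / 2) := by gcongr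

open Classical in
/-- The number of nodal domains of an eigenfunction without interior singular points. -/
theorem card_nodal_domains_le {φ : ℝ × ℝ → ℝ} {lam s : ℝ} {W : Set (ℝ × ℝ)}
    (hs : s = √lam / π)
    (hφ : ContDiff ℝ 2 φ)
    (hlap : ∀ p ∈ Set.Icc (0 : ℝ) 1 ×ˢ Set.Icc (0 : ℝ) 1, laplacian2 φ p = -lam * φ p)
    (hbd : ∀ p ∈ frontier (Set.Icc (0 : ℝ) 1 ×ˢ Set.Icc (0 : ℝ) 1), φ p = 0)
    (hne : ∃ p ∈ Set.Icc (0 : ℝ) 1 ×ˢ Set.Icc (0 : ℝ) 1, φ p ≠ 0)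
    (hns : ∀ p ∈ Set.Ioo (0 : ℝ) 1 ×ˢ Set.Ioo (0 : ℝ) 1, φ p = 0 → fderiv ℝ φ p ≠ 0)
    (hW : W = {q | q ∈ Set.Ioo (0 : ℝ) 1 ×ˢ Set.Ioo (0 : ℝ) 1 ∧ φ q ≠ 0})
    (F : Finset (Set (ℝ × ℝ))) (hF : ∀ A ∈ F, IsComponentOf W A) :
    (F.card : ℝ) ≤ 4 * (s + 1) + (s + 1) * (s / 2) := by
  have hAR : ∀ A ∈ F, ∀ q ∈ A, q ∈ Set.Ioo (0 : ℝ) 1 ×ˢ Set.Ioo (0 : ℝ) 1 := by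
    intro A hA q hq
    have := (hF A hA).subset hq
    rw [hW] at this
    exact this.1
  choose! q hq using fun A hA => (hF A hA).nonempty
  have hV := finite_setOf_vertical_eq_zero hφ hlap hbd hne
  have hH := finite_setOf_horizontal_eq_zero hφ hlap hbd hne
  set V := {c ∈ Set.Ioo (0 : ℝ) 1 | ∀ y ∈ Set.Icc (0 : ℝ) 1, φ (c, y) = 0}
  set H := {c ∈ Set.Ioo (0 : ℝ) 1 | ∀ x ∈ Set.Icc (0 : ℝ) 1, φ (x, c) = 0}
  have hVH : IsClosed (V ∪ H) := (hV.union hH).isClosed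
  have hVHI : V ∪ H ⊆ Set.Ioo (0 : ℝ) 1 := Set.union_subset (fun _ h => h.1) fun _ h => h.1
  obtain ⟨δ, ⟨⟨hδ0, hδ1⟩, hδq⟩, hδV, hδV'⟩ : ∃ δ, (δ ∈ Set.Ioo (0 : ℝ) 1 ∧
      ∀ A ∈ F, q A ∈ Set.Ioo δ (1 - δ) ×ˢ Set.Ioo δ (1 - δ)) ∧ δ ∉ V ∪ H ∧ 1 - δ ∉ V ∪ H := by
    have hsub : Filter.Tendsto (fun δ : ℝ => 1 - δ) (nhds 0) (nhds 1) := by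
      have h : Continuous fun δ : ℝ => 1 - δ := by fun_prop
      simpa using h.tendsto 0
    have e1 : ∀ᶠ δ in nhdsWithin (0 : ℝ) (Set.Ioi 0), δ ∉ V ∪ H :=
      nhdsWithin_le_nhds (hVH.isOpen_compl.mem_nhds fun h => (hVHI h).1.false)
    have e2 : ∀ᶠ δ in nhdsWithin (0 : ℝ) (Set.Ioi 0), 1 - δ ∉ V ∪ H :=
      nhdsWithin_le_nhds
        (hsub.eventually (hVH.isOpen_compl.mem_nhds fun h => (hVHI h).2.false))
    have e3 : ∀ᶠ δ in nhdsWithin (0 : ℝ) (Set.Ioi 0),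
        ∀ A ∈ F, q A ∈ Set.Ioo δ (1 - δ) ×ˢ Set.Ioo δ (1 - δ) := by
      refine (Filter.eventually_all_finset F).2 fun A hA => nhdsWithin_le_nhds ?_
      have hqA := hAR A hA _ (hq A hA)
      filter_upwards [eventually_lt_nhds hqA.1.1, eventually_lt_nhds hqA.2.1,
        hsub.eventually (eventually_gt_nhds hqA.1.2),
        hsub.eventually (eventually_gt_nhds hqA.2.2)] with δ h1 h2 h3 h4
      exact ⟨⟨h1, h3⟩, ⟨h2, h4⟩⟩
    have e0 : ∀ᶠ δ in nhdsWithin (0 : ℝ) (Set.Ioi 0), δ ∈ Set.Ioo (0 : ℝ) 1 :=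
      Ioo_mem_nhdsGT zero_lt_one
    obtain ⟨δ, hδ⟩ := (e0.and (e1.and (e2.and e3))).exists
    exact ⟨δ, ⟨hδ.1, hδ.2.2.2⟩, hδ.2.1, hδ.2.2.1⟩
  have hδI : δ ∈ Set.Ioo (0 : ℝ) 1 := ⟨hδ0, hδ1⟩
  have hδI' : 1 - δ ∈ Set.Ioo (0 : ℝ) 1 := ⟨by linarith, by linarith⟩
  set FV : ℝ → Finset (Set (ℝ × ℝ)) := fun c => F.filter fun A => ∃ t ∈ Set.Ioo (0 : ℝ) 1, (c, t) ∈ A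
    with hFV
  set FH : ℝ → Finset (Set (ℝ × ℝ)) := fun c => F.filter fun A => ∃ t ∈ Set.Ioo (0 : ℝ) 1, (t, c) ∈ A
    with hFH
  set F₀ := F.filter fun A => closure A ⊆ Set.Ioo (0 : ℝ) 1 ×ˢ Set.Ioo (0 : ℝ) 1 with hF₀
  have hcV : ∀ c ∈ Set.Ioo (0 : ℝ) 1, c ∉ V ∪ H → ((FV c).card : ℝ) ≤ s + 1 := by
    intro c hc hcV
    rw [hs]
    exact card_le_of_meets_vertical hφ hlap hbd hW hc (fun h => hcV (Or.inl ⟨hc, h⟩)) _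
      (fun A hA => hF A (Finset.mem_filter.1 hA).1) (fun A hA => (Finset.mem_filter.1 hA).2)
  have hcH : ∀ c ∈ Set.Ioo (0 : ℝ) 1, c ∉ V ∪ H → ((FH c).card : ℝ) ≤ s + 1 := by
    intro c hc hcV
    rw [hs]
    exact card_le_of_meets_horizontal hφ hlap hbd hW hc (fun h => hcV (Or.inr ⟨hc, h⟩)) _
      (fun A hA => hF A (Finset.mem_filter.1 hA).1) (fun A hA => (Finset.mem_filter.1 hA).2)
  have hc₀ : (F₀.card : ℝ) ≤ (s + 1) * (s / 2) :=
    card_le_of_closure_subset hs hφ hlap hbd hne hns hW _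
      (fun A hA => hF A (Finset.mem_filter.1 hA).1) (fun A hA => (Finset.mem_filter.1 hA).2)
  have hcover : F ⊆ FV δ ∪ FV (1 - δ) ∪ (FH δ ∪ FH (1 - δ)) ∪ F₀ := by
    intro A hA
    by_contra hno
    simp only [hFV, hFH, hF₀, Finset.mem_union, Finset.mem_filter, not_or, not_and] at hno
    obtain ⟨⟨⟨h1, h2⟩, h3, h4⟩, h5⟩ := hno
    have hfst : ∀ c, (A ∈ F → ¬ ∃ t ∈ Set.Ioo (0 : ℝ) 1, (c, t) ∈ A) → c ∉ Prod.fst '' A := by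
      rintro c hc ⟨z, hz, rfl⟩
      exact hc hA ⟨z.2, (hAR A hA z hz).2, hz⟩
    have hsnd : ∀ c, (A ∈ F → ¬ ∃ t ∈ Set.Ioo (0 : ℝ) 1, (t, c) ∈ A) → c ∉ Prod.snd '' A := by
      rintro c hc ⟨z, hz, rfl⟩
      exact hc hA ⟨z.1, (hAR A hA z hz).1, hz⟩
    have i1 := ((hF A hA).isPreconnected.image Prod.fst continuous_fst.continuousOn).forall_mem_Ioo
      (hfst _ h1) (hfst _ h2) ⟨q A, hq A hA, rfl⟩ (hδq A hA).1
    have i2 := ((hF A hA).isPreconnected.image Prod.snd continuous_snd.continuousOn).forall_mem_Ioo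
      (hsnd _ h3) (hsnd _ h4) ⟨q A, hq A hA, rfl⟩ (hδq A hA).2
    refine h5 hA ?_
    have hsub : closure A ⊆ Set.Icc δ (1 - δ) ×ˢ Set.Icc δ (1 - δ) :=
      closure_minimal (fun z hz => ⟨Set.Ioo_subset_Icc_self (i1 _ ⟨z, hz, rfl⟩),
        Set.Ioo_subset_Icc_self (i2 _ ⟨z, hz, rfl⟩)⟩) (isClosed_Icc.prod isClosed_Icc)
    exact hsub.trans (Set.prod_mono (Set.Icc_subset_Ioo hδ0 (by linarith))
      (Set.Icc_subset_Ioo hδ0 (by linarith)))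
  have hcard : F.card ≤ (FV δ).card + (FV (1 - δ)).card + ((FH δ).card + (FH (1 - δ)).card) +
      F₀.card :=
    (Finset.card_le_card hcover).trans <| (Finset.card_union_le _ _).trans <|
      Nat.add_le_add_right ((Finset.card_union_le _ _).trans
        (Nat.add_le_add (Finset.card_union_le _ _) (Finset.card_union_le _ _))) _
  have hcard' : (F.card : ℝ) ≤ (FV δ).card + (FV (1 - δ)).card +
      ((FH δ).card + (FH (1 - δ)).card) + F₀.card := by exact_mod_cast hcard
  linarith [hcV δ hδI hδV, hcV _ hδI' hδV', hcH δ hδI hδV, hcH _ hδI' hδV']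

theorem Set.finite_of_forall_finset_card_le {α : Type*} {S : Set α} {B : ℝ}
    (h : ∀ F : Finset α, (F : Set α) ⊆ S → (F.card : ℝ) ≤ B) : S.Finite ∧ (S.ncard : ℝ) ≤ B := by
  have hfin : S.Finite := by
    by_contra hinf
    obtain ⟨F, hF, hcard⟩ := Set.Infinite.exists_subset_card_eq hinf (⌊B⌋₊ + 1)
    have := h F hF
    rw [hcard] at this
    push_cast at this
    exact (Nat.lt_floor_add_one B).not_ge this
  refine ⟨hfin, ?_⟩
  rw [Set.ncard_eq_toFinset_card S hfin]
  exact h _ (by simp)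

/-- there is `C > 0` such that every Dirichlet eigenfunction on the unit
square with eigenvalue `λ` and no interior singular point has at most
`(2/π)·j(λ) + C·√λ` nodal domains. -/
theorem nodal_domain_bound_square_weyl :
    ∃ C : ℝ, 0 < C ∧
      ∀ (φ : ℝ × ℝ → ℝ) (lam : ℝ), 0 < lam →
        ContDiff ℝ 2 φ →
        (∀ p ∈ Set.Icc (0 : ℝ) 1 ×ˢ Set.Icc (0 : ℝ) 1, laplacian2 φ p = -lam * φ p) →
        (∀ p ∈ frontier (Set.Icc (0 : ℝ) 1 ×ˢ Set.Icc (0 : ℝ) 1), φ p = 0) →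
        (∃ p ∈ Set.Icc (0 : ℝ) 1 ×ˢ Set.Icc (0 : ℝ) 1, φ p ≠ 0) →
        (∀ p ∈ Set.Ioo (0 : ℝ) 1 ×ˢ Set.Ioo (0 : ℝ) 1, φ p = 0 → fderiv ℝ φ p ≠ 0) →
        (({C' : Set (ℝ × ℝ) | ∃ p ∈ {q : ℝ × ℝ | q ∈ Set.Ioo (0 : ℝ) 1 ×ˢ Set.Ioo (0 : ℝ) 1 ∧ φ q ≠ 0},
            connectedComponentIn {q : ℝ × ℝ | q ∈ Set.Ioo (0 : ℝ) 1 ×ˢ Set.Ioo (0 : ℝ) 1 ∧ φ q ≠ 0} p = C'}).Finite) ∧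
        (({C' : Set (ℝ × ℝ) | ∃ p ∈ {q : ℝ × ℝ | q ∈ Set.Ioo (0 : ℝ) 1 ×ˢ Set.Ioo (0 : ℝ) 1 ∧ φ q ≠ 0},
            connectedComponentIn {q : ℝ × ℝ | q ∈ Set.Ioo (0 : ℝ) 1 ×ˢ Set.Ioo (0 : ℝ) 1 ∧ φ q ≠ 0} p = C'}).ncard : ℝ)
          ≤ (2 / π) * (squareCounting lam : ℝ) + C * Real.sqrt lam := by
  refine ⟨12, by norm_num, fun φ lam hlam hφ hlap hbd hne hns => ?_⟩
  refine Set.finite_of_forall_finset_card_le fun F hF => ?_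
  rcases F.eq_empty_or_nonempty with rfl | ⟨A, hA⟩
  · simp only [Finset.card_empty, Nat.cast_zero]
    positivity
  set s := √lam / π with hs
  have hsq : √lam = s * π := by
    rw [hs]
    field_simp
  have hcard := card_nodal_domains_le hs hφ hlap hbd hne hns rfl F hF
  have h1 := pi_le_of_subset_strip hφ hlap hbd rfl (hF hA) (α := 0) (β := 1)
    fun q hq => (IsComponentOf.subset (hF hA) hq).1.1
  rw [hsq] at h1
  have hs1 : 1 ≤ s := by nlinarith [pi_pos]
  have hweyl := le_squareCounting (lam := lam) (s := s) (by linarith) (by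
    rw [mul_comm, ← hsq, Real.sq_sqrt hlam.le])
  have h2 : s ^ 2 / 2 ≤ 2 / π * squareCounting lam + 4 / π * s := by
    have := mul_le_mul_of_nonneg_left hweyl (by positivity : 0 ≤ 2 / π)
    calc s ^ 2 / 2 = 2 / π * (π / 4 * s ^ 2) := by
          field_simp
          norm_num
      _ ≤ _ := this
      _ = _ := by ring
  have h3 : 4 / π * s ≤ 2 * s := by
    gcongr
    rw [div_le_iff₀ pi_pos]
    linarith [pi_gt_three]
  rw [hsq]
  nlinarith [pi_gt_three]
end

section
/- Let a, b > 0 and let R = (0,a) × (0,b) ⊂ ℝ². Then for every C¹ function u : ℝ² → ℝ with compact support contained in R, one has ∫_{ℝ²} ‖∇u(x)‖² dx ≥ π²(1/a² + 1/b²) · ∫_{ℝ²} u(x)² dx. -/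
open Real

open MeasureTheory

/-- Where `sin y ≠ 0`, the function `φ y = k * cos y / sin y` satisfies the Riccati equation
`k φ' = -(k² + φ²)`. -/
lemma hasDerivAt_const_mul_cos_div_sin (k : ℝ) {y : ℝ} (hy : sin y ≠ 0) :
    HasDerivAt (fun y => k * (cos y / sin y)) (-k * (1 + (cos y / sin y) ^ 2)) y := by
  refine (((hasDerivAt_cos y).fun_div (hasDerivAt_sin y) hy).const_mul k).congr_deriv ?_
  field_simp
  ring

lemma integrable_sq_of_hasCompactSupport {E : Type*} [TopologicalSpace E] [MeasurableSpace E]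
    [OpensMeasurableSpace E] {μ : Measure E} [IsFiniteMeasureOnCompacts μ] {f : E → ℝ}
    (hf : Continuous f) (hcpt : HasCompactSupport f) : Integrable (fun x => f x ^ 2) μ := by
  simp only [pow_two]
  exact (hf.mul hf).integrable_of_hasCompactSupport hcpt.mul_right

/-- **Poincaré inequality on a slab**: for a compactly supported `C¹` function `u` supported in
`{x | 0 < ℓ x < a}` and a direction `v` with `ℓ v = 1`, one has `(π / a)² ∫ u² ≤ ∫ (∂ᵥ u)²`. -/
lemma slab_poincare {E : Type*} [NormedAddCommGroup E] [NormedSpace ℝ E] [FiniteDimensional ℝ E]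
    [MeasurableSpace E] [BorelSpace E] (μ : Measure E) [μ.IsAddHaarMeasure]
    (ℓ : E →L[ℝ] ℝ) {v : E} (hv : ℓ v = 1) {a : ℝ} (ha : 0 < a) {u : E → ℝ}
    (hu : ContDiff ℝ 1 u) (hcpt : HasCompactSupport u)
    (hsupp : ∀ x ∈ tsupport u, ℓ x ∈ Set.Ioo 0 a) :
    (π / a) ^ 2 * ∫ x, u x ^ 2 ∂μ ≤ ∫ x, (fderiv ℝ u x v) ^ 2 ∂μ := by
  set k := π / a with hk
  have hk0 : 0 < k := by positivity
  have hsin : ∀ x ∈ tsupport u, sin (k * ℓ x) ≠ 0 := fun x hx => by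
    obtain ⟨h0, h1⟩ := hsupp x hx
    refine (sin_pos_of_pos_of_lt_pi (by positivity) ?_).ne'
    calc k * ℓ x < k * a := by gcongr
      _ = π := by rw [hk]; field_simp
  set c : E → ℝ := fun x => k * (cos (k * ℓ x) / sin (k * ℓ x)) with hc
  set w : E → ℝ := fun x => u x * c x with hw
  have hw1 : ContDiff ℝ 1 w := by
    refine contDiff_iff_contDiffAt.2 fun x => ?_
    by_cases hx : x ∈ tsupport u
    · have hlin : ContDiff ℝ 1 fun x => k * ℓ x := contDiff_const.mul ℓ.contDiff
      exact hu.contDiffAt.mul (contDiffAt_const.mul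
        (hlin.cos.contDiffAt.div hlin.sin.contDiffAt (hsin x hx)))
    · refine contDiffAt_const (c := (0 : ℝ)) |>.congr_of_eventuallyEq ?_
      filter_upwards [notMem_tsupport_iff_eventuallyEq.1 hx] with y hy
      simp [hw, hy]
  have hu' : Continuous fun x => fderiv ℝ u x v :=
    (hu.continuous_fderiv one_ne_zero).clm_apply continuous_const
  have hw' : Continuous fun x => fderiv ℝ w x v :=
    (hw1.continuous_fderiv one_ne_zero).clm_apply continuous_const
  have hcpt' : HasCompactSupport fun x => fderiv ℝ u x v := hcpt.fderiv_apply (𝕜 := ℝ) v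
  have int_u'w : Integrable (fun x => fderiv ℝ u x v * w x) μ :=
    (hu'.mul hw1.continuous).integrable_of_hasCompactSupport hcpt'.mul_right
  have int_uw' : Integrable (fun x => u x * fderiv ℝ w x v) μ :=
    (hu.continuous.mul hw').integrable_of_hasCompactSupport hcpt.mul_right
  have int_uw : Integrable (fun x => u x * w x) μ :=
    (hu.continuous.mul hw1.continuous).integrable_of_hasCompactSupport hcpt.mul_right
  have int_u : Integrable (fun x => u x ^ 2) μ :=
    integrable_sq_of_hasCompactSupport hu.continuous hcpt
  have int_u' : Integrable (fun x => (fderiv ℝ u x v) ^ 2) μ :=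
    integrable_sq_of_hasCompactSupport hu' hcpt'
  have parts : ∫ x, u x * fderiv ℝ w x v ∂μ = - ∫ x, fderiv ℝ u x v * w x ∂μ :=
    integral_mul_fderiv_eq_neg_fderiv_mul_of_integrable int_u'w int_uw' int_uw
      (fun x _ => hu.differentiable one_ne_zero x) (fun x _ => hw1.differentiable one_ne_zero x)
  have pointwise : ∀ x, k ^ 2 * u x ^ 2 + (fderiv ℝ u x v * w x + u x * fderiv ℝ w x v) ≤
      (fderiv ℝ u x v) ^ 2 := by
    intro x
    by_cases hx : x ∈ tsupport u
    · have hc' := (hasDerivAt_const_mul_cos_div_sin k (hsin x hx)).comp_hasFDerivAt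
        (f := fun x => k * ℓ x) x (ℓ.hasFDerivAt.const_mul k)
      change HasFDerivAt c _ x at hc'
      have hwx : fderiv ℝ w x v = u x * -(k ^ 2 + c x ^ 2) + c x * fderiv ℝ u x v := by
        rw [((hu.differentiable one_ne_zero x).hasFDerivAt.fun_mul hc').fderiv]
        simp [hv, hc]
        ring
      rw [hwx]
      simp only [hw]
      nlinarith [sq_nonneg (fderiv ℝ u x v - u x * c x)]
    · simp [hw, image_eq_zero_of_notMem_tsupport hx, sq_nonneg]
  calc k ^ 2 * ∫ x, u x ^ 2 ∂μ
      = ∫ x, k ^ 2 * u x ^ 2 + (fderiv ℝ u x v * w x + u x * fderiv ℝ w x v) ∂μ := by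
        rw [integral_add (int_u.const_mul _) (int_u'w.fun_add int_uw'),
          integral_add int_u'w int_uw', integral_const_mul, parts, add_neg_cancel, add_zero]
    _ ≤ _ := integral_mono ((int_u.const_mul (k ^ 2)).add (int_u'w.add int_uw')) int_u' pointwise

/-- the first Dirichlet eigenvalue of the rectangle `(0,a) × (0,b)` is at
least `π²(1/a² + 1/b²)`: for compactly supported `C¹` functions supported in the
rectangle, `∫ ‖∇u‖² ≥ π²(1/a² + 1/b²) ∫ u²`. -/
theorem rectangle_poincare
    (a b : ℝ) (ha : 0 < a) (hb : 0 < b)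
    (u : EuclideanSpace ℝ (Fin 2) → ℝ)
    (hu : ContDiff ℝ 1 u) (hcpt : HasCompactSupport u)
    (hsupp : tsupport u ⊆
      {x : EuclideanSpace ℝ (Fin 2) | x 0 ∈ Set.Ioo 0 a ∧ x 1 ∈ Set.Ioo 0 b}) :
    π ^ 2 * (1 / a ^ 2 + 1 / b ^ 2) * ∫ x, (u x) ^ 2 ≤ ∫ x, ‖gradient u x‖ ^ 2 := by
  have slab (i : Fin 2) {r : ℝ} (hr : 0 < r) (h : ∀ x ∈ tsupport u, x i ∈ Set.Ioo 0 r) :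
      (π / r) ^ 2 * ∫ x, u x ^ 2 ≤ ∫ x, (fderiv ℝ u x (EuclideanSpace.single i 1)) ^ 2 :=
    slab_poincare volume (EuclideanSpace.proj i) (by simp) hr hu hcpt h
  have integrable_sq (v : EuclideanSpace ℝ (Fin 2)) :
      Integrable fun x => (fderiv ℝ u x v) ^ 2 :=
    integrable_sq_of_hasCompactSupport
      ((hu.continuous_fderiv one_ne_zero).clm_apply continuous_const)
      (hcpt.fderiv_apply (𝕜 := ℝ) v)
  have norm_gradient_sq (x : EuclideanSpace ℝ (Fin 2)) : ‖gradient u x‖ ^ 2 =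
      (fderiv ℝ u x (EuclideanSpace.single 0 1)) ^ 2 +
        (fderiv ℝ u x (EuclideanSpace.single 1 1)) ^ 2 := by
    rw [← (EuclideanSpace.basisFun (Fin 2) ℝ).sum_sq_norm_inner_left (gradient u x)]
    simp only [inner_gradient_left, EuclideanSpace.basisFun_apply, Fin.sum_univ_two, norm_eq_abs,
      sq_abs]
  simp_rw [norm_gradient_sq]
  rw [integral_add (integrable_sq _) (integrable_sq _)]
  calc _ = (π / a) ^ 2 * (∫ x, u x ^ 2) + (π / b) ^ 2 * ∫ x, u x ^ 2 := by ring
    _ ≤ _ := add_le_add (slab 0 ha fun x hx => (hsupp hx).1) (slab 1 hb fun x hx => (hsupp hx).2)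
end

section
/- Let φ : ℝ² → ℝ be a C² function and λ > 0 with Δφ = −λφ on the unit square D = [0,1]² and φ = 0 on ∂D. Let U be a connected component of the open set {p ∈ (0,1)² : φ(p) ≠ 0}. If a, b > 0 satisfy π²(1/a² + 1/b²) > λ, then U is not contained in any open rectangle of the form (x₀, x₀+a) × (y₀, y₀+b). -/
open Real

theorem IsLocalMax.deriv_deriv_add_cos_nonpos {f : ℝ → ℝ} {s c k x₀ x : ℝ} (hf : ContDiff ℝ 2 f)
    (h : IsLocalMax (fun t => s * f t - c * cos (k * (t - x₀))) x) :
    s * deriv (deriv f) x + c * k ^ 2 * cos (k * (x - x₀)) ≤ 0 := by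
  have hf₁ : Differentiable ℝ f := hf.differentiable (by norm_num)
  have hf₂ : Differentiable ℝ (deriv f) := hf.differentiable_deriv_two
  have hlin (t : ℝ) : HasDerivAt (fun t => k * (t - x₀)) k t := by
    simpa using ((hasDerivAt_id t).sub_const x₀).const_mul k
  have h₁ : deriv (fun t => s * f t - c * cos (k * (t - x₀))) =
      fun t => s * deriv f t - c * (-sin (k * (t - x₀)) * k) :=
    funext fun t => (((hf₁ t).hasDerivAt.const_mul s).sub ((hlin t).cos.const_mul c)).deriv
  have h₂ : deriv (fun t => s * deriv f t - c * (-sin (k * (t - x₀)) * k)) x =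
      s * deriv (deriv f) x - c * (-(cos (k * (x - x₀)) * k) * k) :=
    (((hf₂ x).hasDerivAt.const_mul s).sub (((hlin x).sin.neg.mul_const k).const_mul c)).deriv
  have hcont := hf.continuous
  have hle := h.deriv_deriv_nonpos (by fun_prop)
  rw [h₁, h₂] at hle
  linarith

theorem mem_connectedComponentIn_of_mem_closure {X : Type*} [TopologicalSpace X] {S : Set X}
    {p q : X} (hp : p ∈ S) (hqS : q ∈ S) (hq : q ∈ closure (connectedComponentIn S p)) :
    q ∈ connectedComponentIn S p := by
  have hpre : IsPreconnected (insert q (connectedComponentIn S p)) :=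
    isPreconnected_connectedComponentIn.subset_closure (Set.subset_insert _ _)
      (Set.insert_subset hq subset_closure)
  exact hpre.subset_connectedComponentIn (Set.mem_insert_of_mem _ (mem_connectedComponentIn hp))
    (Set.insert_subset hqS (connectedComponentIn_subset S p)) (Set.mem_insert _ _)

theorem cos_mul_sub_midpoint_pos {s a x₀ x : ℝ} (hs : 0 ≤ s) (hs1 : s < 1) (ha : 0 < a)
    (hx : x ∈ Set.Icc x₀ (x₀ + a)) : 0 < cos (s * π / a * (x - (x₀ + a / 2))) := by
  have hrw : s * π / a * (x - (x₀ + a / 2)) = s * π * ((x - (x₀ + a / 2)) / a) := by ring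
  have hsπ : s * π < π := by nlinarith [pi_pos]
  have hsπ0 : 0 ≤ s * π := by positivity
  have h₁ : (x - (x₀ + a / 2)) / a ≤ 1 / 2 := by
    rw [div_le_iff₀ ha]; linarith [hx.2]
  have h₂ : -(1 / 2) ≤ (x - (x₀ + a / 2)) / a := by
    rw [le_div_iff₀ ha]; linarith [hx.1]
  rw [hrw]
  apply cos_pos_of_mem_Ioo
  constructor <;> nlinarith

theorem exists_lt_one_lt_sq_mul {l m : ℝ} (h : l < m) :
    ∃ s : ℝ, 0 < s ∧ s < 1 ∧ l < s ^ 2 * m := by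
  have hcont : Filter.Tendsto (fun s : ℝ => s ^ 2 * m) (nhdsWithin 1 (Set.Iio 1)) (nhds m) := by
    have : Continuous fun s : ℝ => s ^ 2 * m := by fun_prop
    simpa using (this.tendsto 1).mono_left nhdsWithin_le_nhds
  have hpos : ∀ᶠ s : ℝ in nhdsWithin 1 (Set.Iio 1), 0 < s :=
    nhdsWithin_le_nhds (lt_mem_nhds one_pos)
  obtain ⟨s, hs, hs0, hs1⟩ :=
    ((hcont.eventually (lt_mem_nhds h)).and (hpos.and self_mem_nhdsWithin)).exists
  exact ⟨s, hs0, hs1, hs⟩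

/-- a nodal domain of a Dirichlet eigenfunction on the unit square with
eigenvalue `λ` cannot be contained in an open rectangle with sides `a, b` when
`π²(1/a² + 1/b²) > λ`. -/
theorem nodal_domain_not_in_small_rectangle
    (φ : ℝ × ℝ → ℝ) (lam : ℝ) (hlam : 0 < lam)
    (hC2 : ContDiff ℝ 2 φ)
    (heig : ∀ p ∈ Set.Icc (0 : ℝ) 1 ×ˢ Set.Icc (0 : ℝ) 1, laplacian2 φ p = -lam * φ p)
    (hbd : ∀ p ∈ frontier (Set.Icc (0 : ℝ) 1 ×ˢ Set.Icc (0 : ℝ) 1), φ p = 0)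
    (U : Set (ℝ × ℝ))
    (hU : ∃ p ∈ {q : ℝ × ℝ | q ∈ Set.Ioo (0 : ℝ) 1 ×ˢ Set.Ioo (0 : ℝ) 1 ∧ φ q ≠ 0},
      connectedComponentIn {q : ℝ × ℝ | q ∈ Set.Ioo (0 : ℝ) 1 ×ˢ Set.Ioo (0 : ℝ) 1 ∧ φ q ≠ 0} p = U)
    (a b : ℝ) (ha : 0 < a) (hb : 0 < b)
    (hab : lam < π ^ 2 * (1 / a ^ 2 + 1 / b ^ 2)) :
    ∀ x₀ y₀ : ℝ, ¬ U ⊆ Set.Ioo x₀ (x₀ + a) ×ˢ Set.Ioo y₀ (y₀ + b) := by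
  intro x₀ y₀ hsub
  obtain ⟨p₀, hp₀, rfl⟩ := hU
  set S := {q : ℝ × ℝ | q ∈ Set.Ioo (0 : ℝ) 1 ×ˢ Set.Ioo (0 : ℝ) 1 ∧ φ q ≠ 0}
  set V := connectedComponentIn S p₀
  have hφ : Continuous φ := hC2.continuous
  have hSopen : IsOpen S :=
    (isOpen_Ioo.prod isOpen_Ioo).inter (isOpen_ne_fun hφ continuous_const)
  have hVopen : IsOpen V := hSopen.connectedComponentIn
  have hVS : V ⊆ S := connectedComponentIn_subset S p₀
  have hp₀V : p₀ ∈ V := mem_connectedComponentIn hp₀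
  have hVsquare : closure V ⊆ Set.Icc (0 : ℝ) 1 ×ˢ Set.Icc (0 : ℝ) 1 :=
    closure_minimal (fun q hq => Set.prod_mono Set.Ioo_subset_Icc_self Set.Ioo_subset_Icc_self
      (hVS hq).1) (isClosed_Icc.prod isClosed_Icc)
  have hVrect : closure V ⊆ Set.Icc x₀ (x₀ + a) ×ˢ Set.Icc y₀ (y₀ + b) :=
    closure_minimal (hsub.trans (Set.prod_mono Set.Ioo_subset_Icc_self Set.Ioo_subset_Icc_self))
      (isClosed_Icc.prod isClosed_Icc)
  have hmem : ∀ q ∈ closure V, φ q ≠ 0 → q ∈ V := by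
    intro q hq hne
    refine mem_connectedComponentIn_of_mem_closure hp₀ ⟨?_, hne⟩ hq
    have hint : q ∈ interior (Set.Icc (0 : ℝ) 1 ×ˢ Set.Icc (0 : ℝ) 1) := by
      by_contra hq'
      exact hne (hbd q ⟨subset_closure (hVsquare hq), hq'⟩)
    rwa [interior_prod_eq, interior_Icc] at hint
  have hcompact : IsCompact (closure V) :=
    (isCompact_Icc.prod isCompact_Icc).of_isClosed_subset isClosed_closure hVsquare
  obtain ⟨s, hs0, hs1, hs⟩ := exists_lt_one_lt_sq_mul hab
  set k := s * π / a with hk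
  set m := s * π / b with hm
  set w : ℝ × ℝ → ℝ := fun q => cos (k * (q.1 - (x₀ + a / 2))) * cos (m * (q.2 - (y₀ + b / 2)))
    with hw
  have hwpos : ∀ q ∈ closure V, 0 < w q := fun q hq =>
    mul_pos (cos_mul_sub_midpoint_pos hs0.le hs1 ha (hVrect hq).1)
      (cos_mul_sub_midpoint_pos hs0.le hs1 hb (hVrect hq).2)
  have hwc : Continuous w := by fun_prop
  obtain ⟨p, hpV, hmax⟩ := hcompact.exists_isMaxOn ⟨p₀, subset_closure hp₀V⟩
    (f := fun q => |φ q| / w q) (hφ.abs.continuousOn.div hwc.continuousOn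
      fun q hq => (hwpos q hq).ne')
  have hM : 0 < |φ p| / w p :=
    (div_pos (abs_pos.2 (hVS hp₀V).2) (hwpos p₀ (subset_closure hp₀V))).trans_le
      (hmax (subset_closure hp₀V))
  have hφp : φ p ≠ 0 := by
    intro h
    simp [h] at hM
  have hp : p ∈ V := hmem p hpV hφp
  set M := |φ p| / w p
  have hMw : M * w p = |φ p| := div_mul_cancel₀ _ (hwpos p hpV).ne'
  obtain ⟨σ, hσp, hσ⟩ : ∃ σ : ℝ, σ * φ p = |φ p| ∧ ∀ q, σ * φ q ≤ |φ q| := by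
    rcases abs_choice (φ p) with h | h
    · exact ⟨1, by rw [h, one_mul], fun q => by rw [one_mul]; exact le_abs_self _⟩
    · exact ⟨-1, by rw [h]; ring, fun q => by rw [neg_one_mul]; exact neg_le_abs _⟩
  have hloc : IsLocalMax (fun q => σ * φ q - M * w q) p := by
    filter_upwards [hVopen.mem_nhds hp] with q hq
    have hqM : |φ q| ≤ M * w q :=
      (div_le_iff₀ (hwpos q (subset_closure hq))).1 (hmax (subset_closure hq))
    linarith [hσ q]
  have hx := IsLocalMax.deriv_deriv_add_cos_nonpos (f := fun x => φ (x, p.2)) (s := σ)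
    (c := M * cos (m * (p.2 - (y₀ + b / 2)))) (k := k) (x₀ := x₀ + a / 2) (x := p.1)
    (hC2.comp (contDiff_id.prodMk contDiff_const)) (by
      have := IsLocalMax.comp_continuous (g := fun x : ℝ => (x, p.2)) (b := p.1) hloc
        (by fun_prop)
      refine this.congr (.of_forall fun x => ?_)
      simp only [hw, Function.comp]
      ring)
  have hy := IsLocalMax.deriv_deriv_add_cos_nonpos (f := fun y => φ (p.1, y)) (s := σ)
    (c := M * cos (k * (p.1 - (x₀ + a / 2)))) (k := m) (x₀ := y₀ + b / 2) (x := p.2)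
    (hC2.comp (contDiff_const.prodMk contDiff_id)) (by
      have := IsLocalMax.comp_continuous (g := fun y : ℝ => (p.1, y)) (b := p.2) hloc
        (by fun_prop)
      refine this.congr (.of_forall fun y => ?_)
      simp only [hw, Function.comp]
      ring)
  have hlap := heig p (hVsquare hpV)
  rw [laplacian2] at hlap
  have hkm : k ^ 2 + m ^ 2 = s ^ 2 * (π ^ 2 * (1 / a ^ 2 + 1 / b ^ 2)) := by
    rw [hk, hm]; ring
  have hsum : (k ^ 2 + m ^ 2 - lam) * |φ p| ≤ 0 := by
    have hlapσ := congrArg (σ * ·) hlap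
    simp only [hw] at hMw hlapσ
    linear_combination hx + hy - hlapσ + lam * hσp - (k ^ 2 + m ^ 2) * hMw
  have : 0 < (k ^ 2 + m ^ 2 - lam) * |φ p| :=
    mul_pos (by linarith) (abs_pos.2 hφp)
  linarith
end

section
/- Fix real numbers θ and ε with θ > ε > 0. Then there exists a finite set P ⊂ ℤ² ∖ {(0,0)} with the following property: for every positive integer n and every α ∈ ℝ, if no integer solution (a,b) of a² + b² = n lies in the open sector S_{α,2θ} = {(r cos φ, r sin φ) : r > 0, α < φ < α + 2θ}, then there exists (p,q) ∈ P such that |ap + bq| ≤ √n · √(p² + q²) · cos(θ − ε) for every (a,b) ∈ ℤ² with a² + b² = n. -/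
open Real

/-- The open sector `S_{α,β} = {(r cos φ, r sin φ) : r > 0, α < φ < α + β}`. -/
def openSector (α β : ℝ) : Set (ℝ × ℝ) :=
  {x : ℝ × ℝ | ∃ r φ : ℝ, 0 < r ∧ α < φ ∧ φ < α + β ∧
    x = (r * Real.cos φ, r * Real.sin φ)}

/-- Polar coordinates of a complex number, with the angle measured from `m`. -/
lemma eq_norm_mul_cos_sin_add_arg (m : ℝ) (w : ℂ) :
    w.re = ‖w‖ * Real.cos (m + Complex.arg (w * Complex.exp (-(m * Complex.I)))) ∧
      w.im = ‖w‖ * Real.sin (m + Complex.arg (w * Complex.exp (-(m * Complex.I)))) := by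
  set z := w * Complex.exp (-(m * Complex.I)) with hz
  have hnorm : ‖z‖ = ‖w‖ := by
    have h : ‖Complex.exp (-(m * Complex.I))‖ = 1 := by
      have := Complex.norm_exp_ofReal_mul_I (-m)
      simpa using this
    rw [hz, norm_mul, h, mul_one]
  have hw : w = ((‖w‖ : ℝ) : ℂ) * Complex.exp (((m + Complex.arg z : ℝ) : ℂ) * Complex.I) := by
    have h := Complex.norm_mul_exp_arg_mul_I z
    rw [hnorm] at h
    push_cast
    rw [add_mul, Complex.exp_add, mul_left_comm, h, hz, mul_left_comm, ← Complex.exp_add]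
    simp
  have hre := congrArg Complex.re hw
  have him := congrArg Complex.im hw
  rw [Complex.re_ofReal_mul, Complex.exp_ofReal_mul_I_re] at hre
  rw [Complex.im_ofReal_mul, Complex.exp_ofReal_mul_I_im] at him
  exact ⟨hre, him⟩

/-- Every vector of the plane is, up to sign, at angle at most `π / 2` from the direction `m`. -/
lemma exists_abs_le_pi_div_two_polar (m x y : ℝ) :
    ∃ t : ℝ, |t| ≤ π / 2 ∧
      ((x = √(x ^ 2 + y ^ 2) * Real.cos (m + t) ∧ y = √(x ^ 2 + y ^ 2) * Real.sin (m + t)) ∨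
        (-x = √(x ^ 2 + y ^ 2) * Real.cos (m + t) ∧
          -y = √(x ^ 2 + y ^ 2) * Real.sin (m + t))) := by
  have key (x y : ℝ) (h : 0 ≤ ((⟨x, y⟩ : ℂ) * Complex.exp (-(m * Complex.I))).re) :
      ∃ t : ℝ, |t| ≤ π / 2 ∧
        x = √(x ^ 2 + y ^ 2) * Real.cos (m + t) ∧ y = √(x ^ 2 + y ^ 2) * Real.sin (m + t) := by
    refine ⟨_, Complex.abs_arg_le_pi_div_two_iff.2 h, ?_⟩
    have hn : ‖(⟨x, y⟩ : ℂ)‖ = √(x ^ 2 + y ^ 2) := by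
      rw [Complex.norm_eq_sqrt_sq_add_sq]
    have := eq_norm_mul_cos_sin_add_arg m ⟨x, y⟩
    rwa [hn] at this
  rcases le_total 0 ((⟨x, y⟩ : ℂ) * Complex.exp (-(m * Complex.I))).re with h | h
  · obtain ⟨t, ht, h⟩ := key x y h
    exact ⟨t, ht, Or.inl h⟩
  · obtain ⟨t, ht, h⟩ := key (-x) (-y) (by
      have hneg : (⟨-x, -y⟩ : ℂ) = -⟨x, y⟩ := rfl
      rw [hneg, neg_mul, Complex.neg_re]
      linarith)
    rw [neg_sq, neg_sq] at h
    exact ⟨t, ht, Or.inr h⟩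

/-- Finitely many integer vectors suffice to approximate every direction to within `ε`. -/
lemma exists_finset_int_directions (ε : ℝ) (hε : 0 < ε) :
    ∃ P : Finset (ℤ × ℤ), (0, 0) ∉ P ∧ ∀ m : ℝ, ∃ pq ∈ P, ∃ δ : ℝ, |δ| < ε ∧
      (pq.1 : ℝ) = √((pq.1 : ℝ) ^ 2 + (pq.2 : ℝ) ^ 2) * Real.cos (m + δ) ∧
      (pq.2 : ℝ) = √((pq.1 : ℝ) ^ 2 + (pq.2 : ℝ) ^ 2) * Real.sin (m + δ) := by
  have hcont : ContinuousAt Complex.arg 1 := Complex.continuousAt_arg (by simp)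
  obtain ⟨η, hη, hη'⟩ := Metric.continuousAt_iff.1 hcont ε hε
  simp only [dist_eq_norm, Complex.arg_one, sub_zero, Real.norm_eq_abs] at hη'
  obtain ⟨N, hN⟩ := exists_nat_gt (2 / min η 1)
  have hmin : 0 < min η 1 := lt_min hη one_pos
  have hN0 : (0 : ℝ) < N := lt_trans (by positivity) hN
  refine ⟨(Finset.Icc (-(N : ℤ)) N ×ˢ Finset.Icc (-(N : ℤ)) N).erase (0, 0), by simp, fun m => ?_⟩
  have hmem (c : ℝ) (h1 : -1 ≤ c) (h2 : c ≤ 1) :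
      ⌊N * c⌋ ∈ Finset.Icc (-(N : ℤ)) N := by
    rw [Finset.mem_Icc, Int.le_floor]
    constructor
    · push_cast
      nlinarith
    · have h : (⌊N * c⌋ : ℝ) ≤ N := (Int.floor_le _).trans (by nlinarith)
      exact_mod_cast h
  set p := ⌊N * Real.cos m⌋ with hp
  set q := ⌊N * Real.sin m⌋ with hq
  set v : ℂ := ⟨p, q⟩ with hv
  have hdist : ‖v - N * Complex.exp (m * Complex.I)‖ ≤ 2 := by
    refine (Complex.norm_le_abs_re_add_abs_im _).trans ?_
    have hre : (v - N * Complex.exp (m * Complex.I)).re = p - N * Real.cos m := by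
      rw [Complex.sub_re, ← Complex.ofReal_natCast, Complex.re_ofReal_mul,
        Complex.exp_ofReal_mul_I_re]
    have him : (v - N * Complex.exp (m * Complex.I)).im = q - N * Real.sin m := by
      rw [Complex.sub_im, ← Complex.ofReal_natCast, Complex.im_ofReal_mul,
        Complex.exp_ofReal_mul_I_im]
    have hfloor (y : ℝ) : |(⌊y⌋ : ℝ) - y| ≤ 1 := by
      rw [abs_le]
      constructor <;> linarith [Int.floor_le y, Int.lt_floor_add_one y]
    rw [hre, him]
    linarith [hfloor (N * Real.cos m), hfloor (N * Real.sin m)]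
  set z : ℂ := v * Complex.exp (-(m * Complex.I)) with hz
  have hclose : ‖((N⁻¹ : ℝ) : ℂ) * z - 1‖ < min η 1 := by
    have hN' : (N : ℂ) ≠ 0 := by exact_mod_cast hN0.ne'
    have heq : ((N⁻¹ : ℝ) : ℂ) * z - 1 = ((N⁻¹ : ℝ) : ℂ) *
        ((v - N * Complex.exp (m * Complex.I)) * Complex.exp (((-m : ℝ) : ℂ) * Complex.I)) := by
      have h1 : Complex.exp (m * Complex.I) * Complex.exp (-(m * Complex.I)) = 1 := by
        rw [← Complex.exp_add]
        simp
      push_cast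
      rw [hz, neg_mul, sub_mul, mul_sub, mul_assoc (N : ℂ), h1]
      field_simp
    rw [heq, norm_mul, norm_mul, Complex.norm_exp_ofReal_mul_I, mul_one, Complex.norm_real,
      Real.norm_of_nonneg (by positivity)]
    rw [div_lt_iff₀ hmin] at hN
    rw [inv_mul_lt_iff₀ hN0]
    linarith
  have harg : |Complex.arg z| < ε := by
    have h := hη' (hclose.trans_le (min_le_left _ _))
    rwa [Complex.arg_real_mul _ (by positivity)] at h
  have hpolar := eq_norm_mul_cos_sin_add_arg m v
  have hvnorm : ‖v‖ = √((p : ℝ) ^ 2 + (q : ℝ) ^ 2) := by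
    rw [Complex.norm_eq_sqrt_sq_add_sq]
  rw [hvnorm] at hpolar
  refine ⟨(p, q), ?_, _, harg, hpolar⟩
  rw [Finset.mem_erase, Finset.mem_product]
  refine ⟨fun h0 => ?_, hmem _ (Real.neg_one_le_cos m) (Real.cos_le_one m),
    hmem _ (Real.neg_one_le_sin m) (Real.sin_le_one m)⟩
  have hv0 : v = 0 := by
    rw [Prod.mk.injEq] at h0
    rw [hv, h0.1, h0.2]
    simp [Complex.ext_iff]
  have h := hclose.trans_le (min_le_right _ _)
  rw [hz, hv0] at h
  simp at h

lemma abs_cos_le_cos {x c : ℝ} (hc : 0 ≤ c) (h1 : c ≤ |x|) (h2 : |x| ≤ π - c) :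
    |Real.cos x| ≤ Real.cos c := by
  rw [← Real.cos_abs x, abs_le]
  constructor
  · rw [← Real.cos_pi_sub]
    exact Real.cos_le_cos_of_nonneg_of_le_pi (abs_nonneg x) (by linarith) h2
  · exact Real.cos_le_cos_of_nonneg_of_le_pi hc (by linarith) h1

/-- for `θ > ε > 0` there is a finite set `P` of nonzero integer vectors
such that whenever all integer solutions of `a² + b² = n` avoid some open sector of
angle `2θ`, there is `(p,q) ∈ P` with `|ap + bq| ≤ √n √(p²+q²) cos(θ−ε)` for all
solutions `(a,b)`. -/
theorem sector_avoiding_direction (θ ε : ℝ) (hε : 0 < ε) (hθε : ε < θ) :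
    ∃ P : Finset (ℤ × ℤ), (0, 0) ∉ P ∧
      ∀ n : ℕ, 0 < n → ∀ α : ℝ,
        (∀ a b : ℤ, a ^ 2 + b ^ 2 = (n : ℤ) →
          ((a : ℝ), (b : ℝ)) ∉ openSector α (2 * θ)) →
        ∃ pq ∈ P, ∀ a b : ℤ, a ^ 2 + b ^ 2 = (n : ℤ) →
          |(a : ℝ) * pq.1 + (b : ℝ) * pq.2| ≤
            Real.sqrt n * Real.sqrt ((pq.1 : ℝ) ^ 2 + (pq.2 : ℝ) ^ 2) * Real.cos (θ - ε) := by
  obtain ⟨P, hP0, hP⟩ := exists_finset_int_directions ε hε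
  refine ⟨P, hP0, fun n hn α hα => ?_⟩
  obtain ⟨⟨p, q⟩, hpq, δ, hδ, hp, hq⟩ := hP (α + θ)
  refine ⟨(p, q), hpq, fun a b hab => ?_⟩
  dsimp only at hp hq ⊢
  have hab' : (a : ℝ) ^ 2 + (b : ℝ) ^ 2 = n := by exact_mod_cast hab
  have hr : 0 < √(n : ℝ) := Real.sqrt_pos.2 (by exact_mod_cast hn)
  obtain ⟨t, ht, h⟩ := exists_abs_le_pi_div_two_polar (α + θ) a b
  rw [hab'] at h
  have hθt : θ ≤ |t| := by
    by_contra! hlt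
    obtain ⟨hlt1, hlt2⟩ := abs_lt.1 hlt
    rcases h with ⟨hx, hy⟩ | ⟨hx, hy⟩
    · exact hα a b hab ⟨_, α + θ + t, hr, by linarith, by linarith, by rw [← hx, ← hy]⟩
    · refine hα (-a) (-b) (by rw [neg_sq, neg_sq, hab])
        ⟨_, α + θ + t, hr, by linarith, by linarith, ?_⟩
      rw [← hx, ← hy]
      push_cast
      rfl
  have hcos : |Real.cos (t - δ)| ≤ Real.cos (θ - ε) := by
    apply abs_cos_le_cos
    · linarith
    · linarith [abs_sub_abs_le_abs_sub t δ]
    · linarith [abs_sub t δ]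
  set R := √((p : ℝ) ^ 2 + (q : ℝ) ^ 2)
  have hR : 0 ≤ R := Real.sqrt_nonneg _
  have hdiff : Real.cos (t - δ) = Real.cos (α + θ + t) * Real.cos (α + θ + δ) +
      Real.sin (α + θ + t) * Real.sin (α + θ + δ) := by
    rw [← Real.cos_sub]
    congr 1
    ring
  have habs : |(a : ℝ) * p + b * q| = √n * R * |Real.cos (t - δ)| := by
    rw [← abs_of_nonneg (mul_nonneg hr.le hR), ← abs_mul, hdiff, hp, hq]
    rcases h with ⟨hx, hy⟩ | ⟨hx, hy⟩
    · rw [hx, hy]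
      congr 1
      ring
    · rw [neg_eq_iff_eq_neg.1 hx, neg_eq_iff_eq_neg.1 hy, ← abs_neg]
      congr 1
      ring
  rw [habs]
  gcongr
end

section
/- Let a and b be coprime positive integers with a ≠ b. For t ∈ ℝ, define φ_t(x,y) = sin(πax)sin(πby) + t·sin(πbx)sin(πay). Then the set of t ∈ ℝ for which φ_t has an interior singular point — that is, a point p ∈ (0,1)² with φ_t(p) = 0 and ∇φ_t(p) = (0,0) — is finite. -/
open Real

/-- The sines of `π a x` and `π b x` have no common zero in `(0,1)` when `a` and `b` are coprime. -/
lemma sin_ne_zero_of_sin_eq_zero {a b : ℕ} (hcop : Nat.Coprime a b) {x : ℝ}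
    (hx : x ∈ Set.Ioo (0 : ℝ) 1) (h : Real.sin (π * a * x) = 0) : Real.sin (π * b * x) ≠ 0 := by
  intro h'
  obtain ⟨n, hn⟩ := Real.sin_eq_zero_iff.mp h
  obtain ⟨m, hm⟩ := Real.sin_eq_zero_iff.mp h'
  have hn' : (a : ℝ) * x = n := mul_left_cancel₀ pi_ne_zero (by linarith)
  have hm' : (b : ℝ) * x = m := mul_left_cancel₀ pi_ne_zero (by linarith)
  obtain ⟨u, v, huv⟩ := Nat.isCoprime_iff_coprime.mpr hcop
  have huv' : (u : ℝ) * a + v * b = 1 := by exact_mod_cast huv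
  have hxi : x = ((u * n + v * m : ℤ) : ℝ) := by
    push_cast
    linear_combination (-x) * huv' + u * hn' + v * hm'
  obtain ⟨h0, h1⟩ := hx
  rw [hxi] at h0 h1
  have h0' : 0 < u * n + v * m := by exact_mod_cast h0
  have h1' : u * n + v * m < 1 := by exact_mod_cast h1
  omega

lemma cos_ne_zero_of_sin_eq_zero {θ : ℝ} (h : Real.sin θ = 0) : Real.cos θ ≠ 0 := by
  intro h'
  simpa [h, h'] using Real.sin_sq_add_cos_sq θ

/-- The Wronskian of `sin (π a x)` and `sin (π b x)`, divided by `π`. -/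
noncomputable def sineWronskian (a b : ℕ) (x : ℝ) : ℝ :=
  a * Real.cos (π * a * x) * Real.sin (π * b * x) -
    b * (Real.sin (π * a * x) * Real.cos (π * b * x))

lemma hasDerivAt_sineWronskian (a b : ℕ) (x : ℝ) :
    HasDerivAt (sineWronskian a b)
      (π * ((b : ℝ) ^ 2 - (a : ℝ) ^ 2) * (Real.sin (π * a * x) * Real.sin (π * b * x))) x := by
  have hl (c : ℕ) : HasDerivAt (fun x : ℝ => π * c * x) (π * c) x := by
    simpa using (hasDerivAt_id x).const_mul (π * c)
  have := ((((hl a).cos.const_mul (a : ℝ)).mul (hl b).sin).sub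
    (((hl a).sin.mul (hl b).cos).const_mul (b : ℝ)))
  refine this.congr_deriv ?_
  ring

lemma analyticOnNhd_sineWronskian (a b : ℕ) :
    AnalyticOnNhd ℝ (sineWronskian a b) Set.univ := by
  intro x _
  unfold sineWronskian
  fun_prop

lemma exists_sineWronskian_ne_zero {a b : ℕ} (ha : 0 < a) (hb : 0 < b) (hab : a ≠ b) :
    ∃ x, sineWronskian a b x ≠ 0 := by
  by_contra! h
  have ha' : (0 : ℝ) < a := by exact_mod_cast ha
  have hb' : (0 : ℝ) < b := by exact_mod_cast hb
  have hpos (c : ℝ) (hc : 0 < c) (hca : c < a + b) :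
      0 < Real.sin (π * c * (1 / (a + b))) := by
    apply Real.sin_pos_of_pos_of_lt_pi
    · positivity
    · rw [mul_one_div, div_lt_iff₀ (by positivity)]
      gcongr
  have hd := hasDerivAt_sineWronskian a b (1 / (a + b))
  have hz : sineWronskian a b = fun _ => 0 := funext h
  rw [hz] at hd
  have he := hd.unique (hasDerivAt_const _ _)
  have hsq : (b : ℝ) ^ 2 - (a : ℝ) ^ 2 ≠ 0 := by
    rw [sub_ne_zero]
    intro hsq
    exact hab (by exact_mod_cast ((sq_eq_sq₀ hb'.le ha'.le).mp hsq).symm)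
  exact mul_ne_zero (mul_ne_zero pi_ne_zero hsq)
    (mul_pos (hpos a ha' (by linarith)) (hpos b hb' (by linarith))).ne' he

lemma finite_sineWronskian_zeros {a b : ℕ} (ha : 0 < a) (hb : 0 < b) (hab : a ≠ b) :
    {x ∈ Set.Ioo (0 : ℝ) 1 | sineWronskian a b x = 0}.Finite := by
  by_contra hinf
  obtain ⟨z, -, hz⟩ := Set.Infinite.exists_accPt_of_subset_isCompact hinf
    (isCompact_Icc (a := (0 : ℝ)) (b := 1)) (fun x hx => Set.Ioo_subset_Icc_self hx.1)
  rw [accPt_iff_frequently_nhdsNE] at hz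
  have := (analyticOnNhd_sineWronskian a b).eqOn_zero_of_preconnected_of_frequently_eq_zero
    isPreconnected_univ (Set.mem_univ z) (hz.mono fun x hx => hx.2)
  obtain ⟨x, hx⟩ := exists_sineWronskian_ne_zero ha hb hab
  exact hx (this (Set.mem_univ x))

lemma hasFDerivAt_sine_combination (a b : ℕ) (t : ℝ) (p : ℝ × ℝ) :
    HasFDerivAt (fun q : ℝ × ℝ => Real.sin (π * a * q.1) * Real.sin (π * b * q.2) +
        t * (Real.sin (π * b * q.1) * Real.sin (π * a * q.2)))
      ((π * (a * Real.cos (π * a * p.1) * Real.sin (π * b * p.2) +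
          t * (b * Real.cos (π * b * p.1) * Real.sin (π * a * p.2)))) •
          ContinuousLinearMap.fst ℝ ℝ ℝ +
        (π * (b * Real.sin (π * a * p.1) * Real.cos (π * b * p.2) +
          t * (a * Real.sin (π * b * p.1) * Real.cos (π * a * p.2)))) •
          ContinuousLinearMap.snd ℝ ℝ ℝ) p := by
  have h1 (c : ℕ) := ((hasFDerivAt_fst (𝕜 := ℝ) (p := p)).const_mul (π * c)).sin
  have h2 (c : ℕ) := ((hasFDerivAt_snd (𝕜 := ℝ) (p := p)).const_mul (π * c)).sin
  refine (((h1 a).mul (h2 b)).add (((h1 b).mul (h2 a)).const_mul t)).congr_fderiv ?_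
  ext <;> simp <;> ring



/-- for coprime positive integers `a ≠ b`, the set of `t ∈ ℝ` for which
`φ_t(x,y) = sin(πax)sin(πby) + t·sin(πbx)sin(πay)` has an interior singular point in
`(0,1)²` is finite. -/
theorem singular_parameter_set_finite
    (a b : ℕ) (ha : 0 < a) (hb : 0 < b) (hab : a ≠ b) (hcop : Nat.Coprime a b) :
    {t : ℝ | ∃ p : ℝ × ℝ, p ∈ Set.Ioo (0 : ℝ) 1 ×ˢ Set.Ioo (0 : ℝ) 1 ∧
      (fun q : ℝ × ℝ => Real.sin (π * a * q.1) * Real.sin (π * b * q.2) +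
        t * (Real.sin (π * b * q.1) * Real.sin (π * a * q.2))) p = 0 ∧
      fderiv ℝ (fun q : ℝ × ℝ => Real.sin (π * a * q.1) * Real.sin (π * b * q.2) +
        t * (Real.sin (π * b * q.1) * Real.sin (π * a * q.2))) p = 0}.Finite := by
  set Z := {x ∈ Set.Ioo (0 : ℝ) 1 | sineWronskian a b x = 0}
  have hZ : Z.Finite := finite_sineWronskian_zeros ha hb hab
  have ha' : (a : ℝ) ≠ 0 := by exact_mod_cast ha.ne'
  have hb' : (b : ℝ) ≠ 0 := by exact_mod_cast hb.ne'
  refine (((hZ.prod hZ).image fun q : ℝ × ℝ =>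
    -(Real.sin (π * a * q.1) * Real.sin (π * b * q.2)) /
      (Real.sin (π * b * q.1) * Real.sin (π * a * q.2))).insert 0).subset ?_
  rintro t ⟨⟨x, y⟩, ⟨hx, hy⟩, h0, hd⟩
  rw [(hasFDerivAt_sine_combination a b t (x, y)).fderiv] at hd
  have hdx := congrArg (fun L : ℝ × ℝ →L[ℝ] ℝ => L (1, 0)) hd
  have hdy := congrArg (fun L : ℝ × ℝ →L[ℝ] ℝ => L (0, 1)) hd
  simp [pi_ne_zero] at h0 hdx hdy hx hy
  rcases eq_or_ne t 0 with ht | ht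
  · exact Or.inl ht
  right
  have hFx := sin_ne_zero_of_sin_eq_zero hcop hx
  have hFy := sin_ne_zero_of_sin_eq_zero hcop hy
  have hGx : Real.sin (π * b * x) ≠ 0 := by
    intro h
    have hF : Real.sin (π * a * x) ≠ 0 := fun h' => hFx h' h
    have hGy : Real.sin (π * b * y) = 0 := by simpa [h, hF] using h0
    have hFy' : Real.sin (π * a * y) ≠ 0 := fun h' => hFy h' hGy
    simp [hGy, ht, hb', hFy', cos_ne_zero_of_sin_eq_zero h] at hdx
  have hFy' : Real.sin (π * a * y) ≠ 0 := by
    intro h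
    have hFx' : Real.sin (π * a * x) = 0 := by simpa [h, hFy h] using h0
    simp [h, ha', hFy h, cos_ne_zero_of_sin_eq_zero hFx'] at hdx
  refine ⟨(x, y), ⟨⟨hx, ?_⟩, ⟨hy, ?_⟩⟩, ?_⟩
  · refine (mul_eq_zero.mp (?_ : t * Real.sin (π * a * y) * sineWronskian a b x = 0)).resolve_left
      (mul_ne_zero ht hFy')
    unfold sineWronskian
    linear_combination a * Real.cos (π * a * x) * h0 - Real.sin (π * a * x) * hdx
  · refine (mul_eq_zero.mp (?_ : t * Real.sin (π * b * x) * sineWronskian a b y = 0)).resolve_left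
      (mul_ne_zero ht hGx)
    unfold sineWronskian
    linear_combination Real.sin (π * b * y) * hdy - b * Real.cos (π * b * y) * h0
  · rw [div_eq_iff (mul_ne_zero hGx hFy')]
    linarith
end
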